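/- arXiv:2311.16371 — 2 statements merged into one kernel-verified Lean document; each statement's English description precedes it below -/
import Mathlib

section
/- As X → ∞, ∑_{p ≤ X} (log p / p)(1 − p/X) = log X − γ − ∑_{k ≥ 2} ∑_p (log p)/p^k − 1 + O(exp(−A√(log X))) for some absolute constant A > 0, where γ is Euler's constant. -/
namespace PNTAux
open Complex Metric Set

/-- Borel–Carathéodory bound for the logarithmic derivative of a zero-free entire function on a ball. -/
lemma logDeriv_bound {f : ℂ → ℂ} (hf : Differentiable ℂ f) {r L : ℝ} (hr : 0 < r) (hL : 0 < L)
    (h0 : ∀ z ∈ ball (0 : ℂ) r, f z ≠ 0)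
    (hb : ∀ z ∈ ball (0 : ℂ) r, ‖f z‖ ≤ ‖f 0‖ * Real.exp L) {w : ℂ} (hw : ‖w‖ ≤ r / 2) :
    ‖deriv f w / f w‖ ≤ 24 * L / r := by
  have hd : DifferentiableOn ℂ (fun z => deriv f z / f z) (ball 0 r) := by
    intro z hz
    exact ((hf.deriv z).div (hf z) (h0 z hz)).differentiableWithinAt
  obtain ⟨φ, hφ0, hφ⟩ := hd.isExactOn_ball.with_val_at 0 0
  have h00 : f 0 ≠ 0 := h0 0 (mem_ball_self hr)
  have hφd : DifferentiableOn ℂ φ (ball 0 r) := fun z hz =>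
    (hφ z hz).differentiableAt.differentiableWithinAt
  -- f = f 0 * exp φ
  have key : ∀ z ∈ ball (0 : ℂ) r, f z = f 0 * exp (φ z) := by
    have hconst : ∀ z ∈ ball (0 : ℂ) r, f z * exp (-φ z) = f 0 * exp (-φ 0) := by
      intro z hz
      have hD : ∀ y ∈ ball (0 : ℂ) r, HasDerivAt (fun z => f z * exp (-φ z)) 0 y := by
        intro y hy
        have h1 := (hf y).hasDerivAt.mul ((hφ y hy).neg.cexp)
        refine HasDerivAt.congr_deriv (h1.congr_of_eventuallyEq (Filter.Eventually.of_forall fun z => by simp)) ?_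
        have h2 : deriv f y = f y * (deriv f y / f y) := by rw [mul_div_cancel₀ _ (h0 y hy)]
        simp only [Pi.neg_apply]
        linear_combination (exp (-φ y)) * h2
      refine (convex_ball (0 : ℂ) r).is_const_of_fderivWithin_eq_zero (𝕜 := ℂ)
        (f := fun z => f z * exp (-φ z)) ?_ ?_ hz (mem_ball_self hr)
      · exact fun y hy => (hD y hy).differentiableAt.differentiableWithinAt
      · intro y hy
        rw [fderivWithin_of_isOpen isOpen_ball hy]
        have := (hD y hy).hasFDerivAt.fderiv
        rw [this]; ext; simp
    intro z hz
    have := hconst z hz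
    rw [hφ0, neg_zero, exp_zero, mul_one] at this
    rw [← this, mul_assoc, ← exp_add]; simp
  have hre : MapsTo φ (ball 0 r) {z | z.re ≤ L} := by
    intro z hz
    have h1 := hb z hz
    rw [key z hz, norm_mul, norm_exp] at h1
    have h2 : 0 < ‖f 0‖ := norm_pos_iff.mpr h00
    have := le_of_mul_le_mul_left h1 h2
    simpa using this
  have hbc : ∀ z ∈ closedBall (0 : ℂ) (3 * r / 4), ‖φ z‖ ≤ 6 * L := by
    intro z hz
    rw [mem_closedBall_zero_iff] at hz
    have hz' : z ∈ ball (0 : ℂ) r := by rw [mem_ball_zero_iff]; linarith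
    have := borelCaratheodory_zero hL hφd hre hr hz' hφ0
    refine this.trans ?_
    rw [div_le_iff₀ (by linarith)]
    nlinarith [norm_nonneg z]
  have hsub : closedBall w (r / 4) ⊆ closedBall (0 : ℂ) (3 * r / 4) := by
    apply closedBall_subset_closedBall'
    rw [dist_zero_right]; linarith
  have hsub2 : closedBall (0 : ℂ) (3 * r / 4) ⊆ ball 0 r := closedBall_subset_ball (by linarith)
  have hC := norm_deriv_le_of_forall_mem_sphere_norm_le (f := φ) (c := w) (R := r / 4) (C := 6 * L)
    (by linarith) ?_ ?_
  · have hwr : w ∈ ball (0 : ℂ) r := by rw [mem_ball_zero_iff]; linarith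
    rw [(hφ w hwr).deriv] at hC
    refine hC.trans (le_of_eq ?_)
    field_simp; ring
  · apply DifferentiableOn.diffContOnCl
    rw [closure_ball _ (by positivity)]
    exact hφd.mono (hsub.trans hsub2)
  · intro z hz
    exact hbc z (hsub (sphere_subset_closedBall hz))

/-- Removing a zero by a Blaschke factor. -/
lemma blaschke {f : ℂ → ℂ} (hf : Differentiable ℂ f) {R B : ℝ} (hR : 0 < R)
    (hB : ∀ z ∈ sphere (0 : ℂ) R, ‖f z‖ ≤ B) {ρ : ℂ} (hρ0 : ρ ≠ 0) (hρ : ‖ρ‖ < R) (hz : f ρ = 0)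
    (h0 : f 0 ≠ 0) :
    ∃ g : ℂ → ℂ, Differentiable ℂ g ∧ (∀ z ∈ sphere (0 : ℂ) R, ‖g z‖ ≤ B) ∧
      ‖g 0‖ = ‖f 0‖ * (R / ‖ρ‖) ∧ (∀ z ∈ ball (0 : ℂ) R, g z = 0 → f z = 0) ∧
      (-(deriv f 0 / f 0)).re = (-(deriv g 0 / g 0)).re + ρ.re * (1 / ‖ρ‖ ^ 2 - 1 / R ^ 2) := by
  set h := dslope f ρ with hh
  have hhd : Differentiable ℂ h := by
    rw [← differentiableOn_univ] at hf ⊢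
    exact (differentiableOn_dslope Filter.univ_mem).mpr hf
  have hfh : ∀ z, f z = (z - ρ) * h z := by
    intro z
    have := sub_smul_dslope f ρ z
    rw [hz, sub_zero, smul_eq_mul] at this
    exact this.symm
  have hRc : (R : ℂ) ≠ 0 := by exact_mod_cast hR.ne'
  have hρn : 0 < ‖ρ‖ := norm_pos_iff.mpr hρ0
  have hh0 : h 0 ≠ 0 := by
    intro h'; apply h0; rw [hfh, h', mul_zero]
  refine ⟨fun z => h z * ((R ^ 2 - (starRingEnd ℂ) ρ * z) / R), by fun_prop, ?_, ?_, ?_, ?_⟩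
  · intro z hzs
    have hzn : ‖z‖ = R := by simpa using hzs
    have h1 : ‖((R : ℂ) ^ 2 - (starRingEnd ℂ) ρ * z) / R‖ = ‖z - ρ‖ := by
      have e1 : (R : ℂ) ^ 2 = z * (starRingEnd ℂ) z := by
        rw [mul_conj, normSq_eq_norm_sq, hzn]; push_cast; ring
      have e2 : (R : ℂ) ^ 2 - (starRingEnd ℂ) ρ * z = z * (starRingEnd ℂ) (z - ρ) := by
        rw [e1, map_sub]; ring
      rw [norm_div, e2, norm_mul, RCLike.norm_conj, hzn, norm_real, Real.norm_eq_abs, abs_of_pos hR]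
      field_simp
    rw [norm_mul, h1, mul_comm, ← norm_mul, ← hfh]
    exact hB z hzs
  · have : ‖f 0‖ = ‖ρ‖ * ‖h 0‖ := by rw [hfh, norm_mul]; simp
    rw [this]
    simp only [mul_zero, sub_zero, norm_mul, norm_div, norm_pow, norm_real, Real.norm_eq_abs,
      abs_of_pos hR]
    field_simp
  · intro z hzb hg
    rcases mul_eq_zero.mp hg with h1 | h1
    · rw [hfh, h1, mul_zero]
    · exfalso
      rw [div_eq_zero_iff, or_iff_left hRc, sub_eq_zero] at h1
      have := congrArg norm h1
      rw [norm_pow, norm_real, Real.norm_eq_abs, abs_of_pos hR, norm_mul, RCLike.norm_conj] at this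
      rw [mem_ball_zero_iff] at hzb
      nlinarith [norm_nonneg z]
  · have hd1 : HasDerivAt f (1 * h 0 + (0 - ρ) * deriv h 0) 0 := by
      have := ((hasDerivAt_id (0 : ℂ)).sub_const ρ).mul (hhd 0).hasDerivAt
      refine this.congr_of_eventuallyEq ?_
      exact Filter.Eventually.of_forall fun z => by simp [hfh z]
    have hd2 : HasDerivAt (fun z => h z * ((R ^ 2 - (starRingEnd ℂ) ρ * z) / R))
        (deriv h 0 * ((R ^ 2 - (starRingEnd ℂ) ρ * 0) / R) +
          h 0 * (-((starRingEnd ℂ) ρ * 1) / R)) 0 := by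
      have := (hhd 0).hasDerivAt.mul
        ((((hasDerivAt_id (0 : ℂ)).const_mul ((starRingEnd ℂ) ρ)).const_sub
          ((R : ℂ) ^ 2)).div_const (R : ℂ))
      refine HasDerivAt.congr_deriv (this.congr_of_eventuallyEq (Filter.Eventually.of_forall fun z => by simp)) (by simp)
    rw [hd1.deriv, hd2.deriv]
    have e1 : (1 * h 0 + (0 - ρ) * deriv h 0) / f 0 = -(1 / ρ) + deriv h 0 / h 0 := by
      rw [hfh 0]; field_simp; ring
    have e2 : (deriv h 0 * (((R : ℂ) ^ 2 - (starRingEnd ℂ) ρ * 0) / R) +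
          h 0 * (-((starRingEnd ℂ) ρ * 1) / R)) / (h 0 * (((R : ℂ) ^ 2 - (starRingEnd ℂ) ρ * 0) / R))
          = deriv h 0 / h 0 - (starRingEnd ℂ) ρ / ((R ^ 2 : ℝ) : ℂ) := by
      push_cast
      rw [mul_zero, sub_zero]
      field_simp
      ring
    rw [e1, e2]
    have e3 : (1 / ρ).re = ρ.re / ‖ρ‖ ^ 2 := by
      rw [one_div, inv_re, normSq_eq_norm_sq]
    have e4 : ((starRingEnd ℂ) ρ / ((R ^ 2 : ℝ) : ℂ)).re = ρ.re / R ^ 2 := by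
      rw [div_ofReal_re, conj_re]
    simp only [neg_re, add_re, sub_re, e3, e4]
    ring

/-- Upper bound for the negated real part of the logarithmic derivative when all the zeros lie to the left. -/
lemma neg_re_logDeriv_le {R r L B : ℝ} (hr : 0 < r) (hrR : r < R) (hL : 0 < L) (N : ℕ) :
    ∀ f : ℂ → ℂ, Differentiable ℂ f → (∀ z ∈ sphere (0 : ℂ) R, ‖f z‖ ≤ B) → f 0 ≠ 0 →
      B ≤ ‖f 0‖ * Real.exp L → B ≤ ‖f 0‖ * (R / r) ^ N →
      (∀ z ∈ ball (0 : ℂ) r, f z = 0 → z.re ≤ 0) →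
      (-(deriv f 0 / f 0)).re ≤ 24 * L / r := by
  have hR : 0 < R := hr.trans hrR
  have hmax : ∀ f : ℂ → ℂ, Differentiable ℂ f → (∀ z ∈ sphere (0 : ℂ) R, ‖f z‖ ≤ B) →
      ∀ z ∈ ball (0 : ℂ) R, ‖f z‖ ≤ B := by
    intro f hf hb z hz
    refine norm_le_of_forall_mem_frontier_norm_le (U := ball (0 : ℂ) R) isBounded_ball
      hf.diffContOnCl ?_ (subset_closure hz)
    rw [frontier_ball _ hR.ne']
    exact hb
  induction N with
  | zero =>
    intro f hf hb h0 hB1 hB2 hz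
    have hnz : ∀ z ∈ ball (0 : ℂ) r, f z ≠ 0 := by
      intro ρ hρ h
      have hρ0 : ρ ≠ 0 := by rintro rfl; exact h0 h
      rw [mem_ball_zero_iff] at hρ
      obtain ⟨g, hg, hgb, hg0, -, -⟩ := blaschke hf hR hb hρ0 (hρ.trans hrR) h h0
      have := hmax g hg hgb 0 (mem_ball_self hR)
      rw [hg0] at this
      have h1 : 1 < R / ‖ρ‖ := by
        rw [lt_div_iff₀ (norm_pos_iff.mpr hρ0)]; linarith
      have h2 : 0 < ‖f 0‖ := norm_pos_iff.mpr h0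
      simp at hB2
      nlinarith
    have := logDeriv_bound hf hr hL hnz (fun z hz' =>
      (hmax f hf hb z (ball_subset_ball hrR.le hz')).trans hB1) (w := 0) (by simp; positivity)
    calc (-(deriv f 0 / f 0)).re ≤ ‖-(deriv f 0 / f 0)‖ := re_le_norm _
      _ ≤ _ := by rw [norm_neg]; exact this
  | succ N ih =>
    intro f hf hb h0 hB1 hB2 hz
    by_cases hnz : ∀ z ∈ ball (0 : ℂ) r, f z ≠ 0
    · have := logDeriv_bound hf hr hL hnz (fun z hz' =>
        (hmax f hf hb z (ball_subset_ball hrR.le hz')).trans hB1) (w := 0) (by simp; positivity)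
      calc (-(deriv f 0 / f 0)).re ≤ ‖-(deriv f 0 / f 0)‖ := re_le_norm _
        _ ≤ _ := by rw [norm_neg]; exact this
    push Not at hnz
    obtain ⟨ρ, hρ, h⟩ := hnz
    have hρ0 : ρ ≠ 0 := by rintro rfl; exact h0 h
    have hρn : 0 < ‖ρ‖ := norm_pos_iff.mpr hρ0
    have hρre := hz ρ hρ h
    rw [mem_ball_zero_iff] at hρ
    obtain ⟨g, hg, hgb, hg0, hgz, hgd⟩ := blaschke hf hR hb hρ0 (hρ.trans hrR) h h0
    have hf0 : 0 < ‖f 0‖ := norm_pos_iff.mpr h0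
    have h1 : R / r ≤ R / ‖ρ‖ := by gcongr
    have h2 : 1 < R / r := by rw [lt_div_iff₀ hr]; linarith
    have h3 : ‖f 0‖ * (R / r) ≤ ‖g 0‖ := by rw [hg0]; gcongr
    have h4 : ‖f 0‖ ≤ ‖g 0‖ := by nlinarith
    have := ih g hg hgb (norm_pos_iff.mp (hf0.trans_le h4)) (hB1.trans (by gcongr)) ?_ ?_
    · rw [hgd]
      have : ρ.re * (1 / ‖ρ‖ ^ 2 - 1 / R ^ 2) ≤ 0 := by
        apply mul_nonpos_of_nonpos_of_nonneg hρre
        rw [sub_nonneg]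
        gcongr
        linarith
      linarith
    · refine hB2.trans ?_
      rw [pow_succ', ← mul_assoc]
      gcongr
    · intro z hzb hgz0
      exact hz z hzb (hgz z (ball_subset_ball hrR.le hzb) hgz0)

lemma neg_re_logDeriv_le' {R r L : ℝ} (hr : 0 < r) (hrR : r < R) (hL : 0 < L)
    {f : ℂ → ℂ} (hf : Differentiable ℂ f)
    (hb : ∀ z ∈ sphere (0 : ℂ) R, ‖f z‖ ≤ ‖f 0‖ * Real.exp L) (h0 : f 0 ≠ 0)
    (hz : ∀ z ∈ ball (0 : ℂ) r, f z = 0 → z.re ≤ 0) :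
    (-(deriv f 0 / f 0)).re ≤ 24 * L / r := by
  have h2 : 1 < R / r := by rw [lt_div_iff₀ hr]; linarith
  obtain ⟨N, hN⟩ := pow_unbounded_of_one_lt (Real.exp L) h2
  exact neg_re_logDeriv_le hr hrR hL N f hf hb h0 le_rfl (by gcongr) hz

/-- Same, keeping the contribution of one real zero `-d`. -/
lemma neg_re_logDeriv_le_one {R r L d : ℝ} (hr : 0 < r) (hrR : r < R) (hL : 0 < L)
    {f : ℂ → ℂ} (hf : Differentiable ℂ f)
    (hb : ∀ z ∈ sphere (0 : ℂ) R, ‖f z‖ ≤ ‖f 0‖ * Real.exp L) (h0 : f 0 ≠ 0)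
    (hz : ∀ z ∈ ball (0 : ℂ) r, f z = 0 → z.re ≤ 0) (hd : 0 < d) (hdR : d < R)
    (hfd : f (-(d : ℂ)) = 0) :
    (-(deriv f 0 / f 0)).re ≤ 24 * L / r - 1 / d + d / R ^ 2 := by
  have hR : 0 < R := hr.trans hrR
  have hn : ‖-(d : ℂ)‖ = d := by rw [norm_neg, norm_real, Real.norm_eq_abs, abs_of_pos hd]
  obtain ⟨g, hg, hgb, hg0, hgz, hgd⟩ := blaschke hf hR hb (ρ := -(d : ℂ))
    (by simpa using hd.ne') (by rw [hn]; exact hdR) hfd h0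
  have hf0 : 0 < ‖f 0‖ := norm_pos_iff.mpr h0
  rw [hn] at hg0 hgd
  have h4 : ‖f 0‖ ≤ ‖g 0‖ := by
    rw [hg0]
    have : 1 ≤ R / d := by rw [le_div_iff₀ hd]; linarith
    nlinarith
  have := neg_re_logDeriv_le' hr hrR hL hg (fun z hz => (hgb z hz).trans (by gcongr))
    (norm_pos_iff.mp (hf0.trans_le h4))
    (fun z hzb hgz0 => hz z hzb (hgz z (ball_subset_ball hrR.le hzb) hgz0))
  rw [hgd]
  have e : (-(d : ℂ)).re * (1 / d ^ 2 - 1 / R ^ 2) = - 1 / d + d / R ^ 2 := by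
    simp only [neg_re, ofReal_re]; field_simp; ring
  rw [e]
  have e2 : -1 / d = - (1 / d) := by ring
  rw [e2]; linarith

end PNTAux


namespace PNTAux
open Complex Metric Set Filter Topology

/-- Terms of the series for `(s-1) ζ(s) - 1`. -/
noncomputable def bT (n : ℕ) (s : ℂ) : ℂ :=
  (s - 1) * ((n + 1 : ℝ) : ℂ) ^ (-s) + ((n + 2 : ℝ) : ℂ) ^ (1 - s) - ((n + 1 : ℝ) : ℂ) ^ (1 - s)

lemma bT_diff (n : ℕ) : Differentiable ℂ (bT n) := by
  have h1 : ((n + 1 : ℝ) : ℂ) ≠ 0 := by exact_mod_cast (by positivity : (n + 1 : ℝ) ≠ 0)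
  have h2 : ((n + 2 : ℝ) : ℂ) ≠ 0 := by exact_mod_cast (by positivity : (n + 2 : ℝ) ≠ 0)
  intro s
  unfold bT
  refine DifferentiableAt.sub (DifferentiableAt.add (DifferentiableAt.mul (by fun_prop) ?_) ?_) ?_
  · exact DifferentiableAt.const_cpow (by fun_prop) (Or.inl h1)
  · exact DifferentiableAt.const_cpow (by fun_prop) (Or.inl h2)
  · exact DifferentiableAt.const_cpow (by fun_prop) (Or.inl h1)

lemma hasDeriv_cpow {x : ℝ} (hx : 0 < x) (c : ℂ) :
    HasDerivAt (fun y : ℝ => (y : ℂ) ^ c) (c * (x : ℂ) ^ (c - 1)) x := by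
  have := (hasDerivAt_id (x : ℂ)).cpow_const (c := c) (by left; simpa using hx)
  simpa using this.comp_ofReal

lemma bT_bound (n : ℕ) {s : ℂ} (hs : 0 < s.re) :
    ‖bT n s‖ ≤ ‖s - 1‖ * ‖s‖ * (n + 1 : ℝ) ^ (-s.re - 1) := by
  have hn : (0 : ℝ) < n + 1 := by positivity
  have hpos : ∀ x ∈ Icc (n + 1 : ℝ) (n + 2), 0 < x := fun x hx => hn.trans_le hx.1
  have h1 : ∀ x ∈ Icc (n + 1 : ℝ) (n + 2),
      ‖(x : ℂ) ^ (-s) - ((n + 1 : ℝ) : ℂ) ^ (-s)‖ ≤ ‖s‖ * (n + 1 : ℝ) ^ (-s.re - 1) := by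
    intro x hx
    have := norm_image_sub_le_of_norm_deriv_le_segment' (a := (n + 1 : ℝ)) (b := n + 2)
      (f := fun y : ℝ => (y : ℂ) ^ (-s)) (f' := fun y : ℝ => (-s) * (y : ℂ) ^ (-s - 1))
      (C := ‖s‖ * (n + 1 : ℝ) ^ (-s.re - 1))
      (fun y hy => (hasDeriv_cpow (hpos y hy) (-s)).hasDerivWithinAt) ?_ x hx
    · refine this.trans ?_
      have h : 0 ≤ ‖s‖ * (n + 1 : ℝ) ^ (-s.re - 1) := by positivity
      have : x - (n + 1) ≤ 1 := by linarith [hx.2]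
      nlinarith
    · intro y hy
      have hy0 := hpos y (Ico_subset_Icc_self hy)
      rw [norm_mul, norm_neg, norm_cpow_eq_rpow_re_of_pos hy0]
      gcongr
      simp only [sub_re, neg_re, one_re]
      exact Real.rpow_le_rpow_of_nonpos hn hy.1 (by linarith)
  have := norm_image_sub_le_of_norm_deriv_le_segment' (a := (n + 1 : ℝ)) (b := n + 2)
      (f := fun y : ℝ => (s - 1) * ((n + 1 : ℝ) : ℂ) ^ (-s) * (y : ℂ) + (y : ℂ) ^ (1 - s))
      (f' := fun y : ℝ => (s - 1) * ((n + 1 : ℝ) : ℂ) ^ (-s) + (1 - s) * (y : ℂ) ^ (1 - s - 1))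
      (C := ‖s - 1‖ * ‖s‖ * (n + 1 : ℝ) ^ (-s.re - 1)) ?_ ?_ (n + 2) (by constructor <;> linarith)
  · have e : (n + 2 : ℝ) - (n + 1) = 1 := by ring
    rw [e, mul_one] at this
    have e2 : bT n s = ((s - 1) * ((n + 1 : ℝ) : ℂ) ^ (-s) * ((n + 2 : ℝ) : ℂ) + ((n + 2 : ℝ) : ℂ) ^ (1 - s))
        - ((s - 1) * ((n + 1 : ℝ) : ℂ) ^ (-s) * ((n + 1 : ℝ) : ℂ) + ((n + 1 : ℝ) : ℂ) ^ (1 - s)) := by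
      unfold bT
      push_cast; ring
    rw [e2]
    exact this
  · intro y hy
    refine HasDerivAt.hasDerivWithinAt ?_
    have h2 := ((ofRealCLM.hasDerivAt (x := y)).const_mul ((s - 1) * ((n + 1 : ℝ) : ℂ) ^ (-s))).fun_add
      (hasDeriv_cpow (hpos y hy) (1 - s))
    simpa using h2
  · intro y hy
    have h3 := h1 y (Ico_subset_Icc_self hy)
    have e : (s - 1) * ((n + 1 : ℝ) : ℂ) ^ (-s) + (1 - s) * (y : ℂ) ^ (1 - s - 1) =
      -((s - 1) * ((y : ℂ) ^ (-s) - ((n + 1 : ℝ) : ℂ) ^ (-s))) := by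
      rw [show 1 - s - 1 = -s by ring]; ring
    rw [e, norm_neg, norm_mul, mul_assoc]
    gcongr

lemma summable_u : Summable (fun n : ℕ => (n + 1 : ℝ) ^ (-(5 / 4) : ℝ)) := by
  have := (Real.summable_nat_rpow (p := -(5 / 4))).mpr (by norm_num)
  have h2 := (summable_nat_add_iff 1).mpr this
  simpa using h2

lemma bT_bound' (n : ℕ) {s : ℂ} (hs : 1 / 4 < s.re) :
    ‖bT n s‖ ≤ ‖s - 1‖ * ‖s‖ * (n + 1 : ℝ) ^ (-(5 / 4) : ℝ) := by
  refine (bT_bound n (by linarith)).trans ?_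
  gcongr
  · linarith
  · linarith

lemma zeta1_of_one_lt {s : ℂ} (hs : 1 < s.re) : riemannZeta₁ s = 1 + ∑' n, bT n s := by
  have hs1 : s ≠ 1 := by rintro rfl; simp at hs
  have hz := zeta_eq_tsum_one_div_nat_add_one_cpow hs
  have hsum : Summable (fun n : ℕ => 1 / ((n : ℂ) + 1) ^ s) := by
    have := (summable_nat_add_iff 1).mpr (Complex.summable_one_div_nat_cpow.mpr hs)
    simpa using this
  have h1 : HasSum (fun n : ℕ => (s - 1) * ((n + 1 : ℝ) : ℂ) ^ (-s)) ((s - 1) * riemannZeta s) := by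
    rw [hz]
    refine (hsum.hasSum.mul_left (s - 1)).congr_fun ?_ |> fun h => h
    intro n
    rw [cpow_neg, one_div]; push_cast; rfl
  have hb : Summable (fun n => bT n s) := by
    refine Summable.of_norm_bounded (summable_u.mul_left (‖s - 1‖ * ‖s‖)) fun n => ?_
    exact bT_bound' n (by linarith)
  have h2 : HasSum (fun n : ℕ => bT n s - (s - 1) * ((n + 1 : ℝ) : ℂ) ^ (-s))
      (∑' n, bT n s - (s - 1) * riemannZeta s) := hb.hasSum.sub h1
  have h3 : Tendsto (fun N : ℕ => ∑ n ∈ Finset.range N, (bT n s - (s - 1) * ((n + 1 : ℝ) : ℂ) ^ (-s)))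
      atTop (𝓝 (0 - 1)) := by
    have e : ∀ N : ℕ, ∑ n ∈ Finset.range N, (bT n s - (s - 1) * ((n + 1 : ℝ) : ℂ) ^ (-s)) =
        ((N + 1 : ℝ) : ℂ) ^ (1 - s) - 1 := by
      intro N
      have := Finset.sum_range_sub (fun n : ℕ => ((n + 1 : ℝ) : ℂ) ^ (1 - s)) N
      simp only [Nat.cast_zero, zero_add, ofReal_one, one_cpow] at this
      rw [← this]
      refine Finset.sum_congr rfl fun n _ => ?_
      unfold bT; push_cast
      rw [show (n : ℂ) + 1 + 1 = n + 2 by ring]; ring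
    simp_rw [e]
    refine Tendsto.sub_const ?_ 1
    rw [tendsto_zero_iff_norm_tendsto_zero]
    have e2 : ∀ N : ℕ, ‖((N + 1 : ℝ) : ℂ) ^ (1 - s)‖ = (N + 1 : ℝ) ^ (-(s.re - 1)) := by
      intro N
      rw [norm_cpow_eq_rpow_re_of_pos (by positivity)]; simp
    simp_rw [e2]
    exact (tendsto_rpow_neg_atTop (by linarith)).comp
      (tendsto_atTop_add_const_right _ 1 tendsto_natCast_atTop_atTop)
  have h4 := tendsto_nhds_unique h2.tendsto_sum_nat h3
  have h5 : riemannZeta₁ s = (s - 1) * riemannZeta s := by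
    rw [riemannZeta_eq_inv_sub_mul hs1, ← mul_assoc, mul_inv_cancel₀ (sub_ne_zero.mpr hs1), one_mul]
  rw [h5]; linear_combination -h4

lemma zeta1_eq {s : ℂ} (hs : 1 / 4 < s.re) : riemannZeta₁ s = 1 + ∑' n, bT n s := by
  set k : ℝ := ‖s‖ + 3 with hk
  set U : Set ℂ := {z | 1 / 4 < z.re} ∩ ball 0 k with hU
  have hUo : IsOpen U := (isOpen_lt continuous_const continuous_re).inter isOpen_ball
  have hUc : IsPreconnected U :=
    ((convex_halfSpace_re_gt (1 / 4)).inter (convex_ball 0 k)).isPreconnected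
  have hd : DifferentiableOn ℂ (fun z => ∑' n, bT n z) U := by
    refine differentiableOn_tsum_of_summable_norm (summable_u.mul_left ((k + 1) * k))
      (fun n => (bT_diff n).differentiableOn) hUo ?_
    intro n z hz
    refine (bT_bound' n hz.1).trans ?_
    have h1 : ‖z‖ ≤ k := by have := hz.2; rw [mem_ball_zero_iff] at this; exact this.le
    have h2 : ‖z - 1‖ ≤ k + 1 := (norm_sub_le _ _).trans (by simpa using h1)
    have : 0 ≤ k := (norm_nonneg _).trans h1
    gcongr
  have h2U : (2 : ℂ) ∈ U := by
    refine ⟨by simp; norm_num, ?_⟩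
    rw [mem_ball_zero_iff, hk]; simp; linarith [norm_nonneg s]
  have := (differentiable_riemannZeta₁.differentiableOn.analyticOnNhd hUo).eqOn_of_preconnected_of_eventuallyEq
    ((hd.const_add 1).analyticOnNhd hUo) hUc h2U ?_
  · refine this ⟨hs, ?_⟩
    rw [mem_ball_zero_iff, hk]; linarith
  · have : {z : ℂ | 1 < z.re} ∈ 𝓝 (2 : ℂ) :=
      (isOpen_lt continuous_const continuous_re).mem_nhds (by simp)
    filter_upwards [this] with z hz using zeta1_of_one_lt hz

lemma zeta1_bound : ∃ C : ℝ, 1 ≤ C ∧ ∀ s : ℂ, 1 / 4 < s.re → ‖riemannZeta₁ s‖ ≤ C * (1 + ‖s‖) ^ 2 := by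
  set Z := ∑' n : ℕ, (n + 1 : ℝ) ^ (-(5 / 4) : ℝ) with hZ
  have hZ0 : 0 ≤ Z := tsum_nonneg fun n => by positivity
  refine ⟨1 + Z, by linarith, fun s hs => ?_⟩
  rw [zeta1_eq hs]
  have h1 : ‖∑' n, bT n s‖ ≤ ‖s - 1‖ * ‖s‖ * Z := by
    refine tsum_of_norm_bounded (summable_u.hasSum.mul_left _) fun n => bT_bound' n hs
  have h2 : ‖s - 1‖ ≤ 1 + ‖s‖ := (norm_sub_le _ _).trans (by simp [add_comm])
  have h3 := norm_nonneg s
  have h4 : ‖s - 1‖ * ‖s‖ ≤ (1 + ‖s‖) ^ 2 := by nlinarith [norm_nonneg (s - 1)]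
  calc ‖1 + ∑' n, bT n s‖ ≤ ‖(1 : ℂ)‖ + ‖∑' n, bT n s‖ := norm_add_le _ _
    _ ≤ 1 + ‖s - 1‖ * ‖s‖ * Z := by simpa using h1
    _ ≤ _ := by nlinarith

end PNTAux


namespace PNTAux
open Complex Metric Set Filter Topology

lemma zeta1_eq_mul {s : ℂ} (hs : s ≠ 1) : riemannZeta₁ s = (s - 1) * riemannZeta s := by
  rw [riemannZeta_eq_inv_sub_mul hs, ← mul_assoc, mul_inv_cancel₀ (sub_ne_zero.mpr hs), one_mul]

lemma zeta1_ne_zero {s : ℂ} (hs : 1 ≤ s.re) : riemannZeta₁ s ≠ 0 := by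
  by_cases h : s = 1
  · subst h; simp
  · rw [zeta1_eq_mul h]
    exact mul_ne_zero (sub_ne_zero.mpr h) (riemannZeta_ne_zero_of_one_le_re hs)

/-- The L-series of the von Mangoldt function. -/
noncomputable def VM (s : ℂ) : ℂ := LSeries (fun n => (ArithmeticFunction.vonMangoldt n : ℂ)) s

lemma VM_eq {s : ℂ} (hs : 1 < s.re) : VM s = 1 / (s - 1) - deriv riemannZeta₁ s / riemannZeta₁ s := by
  have hs1 : s ≠ 1 := by rintro rfl; simp at hs
  have h0 : riemannZeta₁ s ≠ 0 := zeta1_ne_zero hs.le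
  have hs2 : s - 1 ≠ 0 := sub_ne_zero.mpr hs1
  unfold VM
  rw [ArithmeticFunction.LSeries_vonMangoldt_eq_deriv_riemannZeta_div hs,
    deriv_riemannZeta_eq_neg_inv_sub_sq_mul_add hs1, riemannZeta_eq_inv_sub_mul hs1]
  field_simp
  ring

lemma three_four_one {σ : ℝ} (hσ : 1 < σ) (t : ℝ) :
    0 ≤ 3 * (VM σ).re + 4 * (VM (σ + t * I)).re + (VM (σ + (2 * t : ℝ) * I)).re := by
  have key : ∀ u : ℝ, HasSum (fun n => (LSeries.term (fun n => (ArithmeticFunction.vonMangoldt n : ℂ)) (σ + u * I) n).re) (VM (σ + u * I)).re := by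
    intro u
    have : LSeriesSummable (fun n => (ArithmeticFunction.vonMangoldt n : ℂ)) (σ + u * I) :=
      ArithmeticFunction.LSeriesSummable_vonMangoldt (by simpa using hσ)
    exact hasSum_re this.hasSum
  have h0 := key 0
  have h1 := key t
  have h2 := key (2 * t)
  have := ((h0.mul_left 3).add (h1.mul_left 4)).add h2
  simp only [ofReal_zero, zero_mul, add_zero] at this
  refine this.nonneg fun n => ?_
  have term : ∀ u : ℝ, n ≠ 0 → (LSeries.term (fun n => (ArithmeticFunction.vonMangoldt n : ℂ)) (σ + u * I) n).re
      = ArithmeticFunction.vonMangoldt n * (n : ℝ) ^ (-σ) * Real.cos (u * Real.log n) := by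
    intro u hn
    have hn' : (n : ℂ) ≠ 0 := by exact_mod_cast hn
    have hnp : (0 : ℝ) < n := by exact_mod_cast Nat.pos_of_ne_zero hn
    rw [LSeries.term_of_ne_zero hn, div_eq_mul_inv, ← cpow_neg, re_ofReal_mul, mul_assoc]
    congr 1
    rw [cpow_def_of_ne_zero hn', ← natCast_log, exp_re, Real.rpow_def_of_pos hnp]
    simp only [mul_re, mul_im, neg_re, neg_im, add_re, add_im, ofReal_re, ofReal_im, I_re, I_im]
    rw [← Real.cos_neg (u * Real.log n)]
    congr 2
    · ring
    · ring
  by_cases hn : n = 0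
  · simp [hn]
  · have e0 := term 0 hn
    simp only [ofReal_zero, zero_mul, add_zero, Real.cos_zero, mul_one] at e0
    rw [e0, term t hn, term (2 * t) hn, mul_assoc 2 t, Real.cos_two_mul]
    have : 0 ≤ ArithmeticFunction.vonMangoldt n * (n : ℝ) ^ (-σ) :=
      mul_nonneg ArithmeticFunction.vonMangoldt_nonneg (by positivity)
    nlinarith [mul_nonneg this (sq_nonneg (1 + Real.cos (t * Real.log n)))]

lemma VM_real_bound : ∃ M : ℝ, 0 ≤ M ∧ ∀ σ : ℝ, 1 < σ → σ ≤ 2 → (VM σ).re ≤ 1 / (σ - 1) + M := by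
  have hc : ContinuousOn (fun s : ℝ => ‖deriv riemannZeta₁ s / riemannZeta₁ s‖) (Icc 1 2) := by
    refine ContinuousOn.norm (ContinuousOn.div ?_ ?_ ?_)
    · exact ((differentiable_riemannZeta₁.deriv.continuous).comp continuous_ofReal).continuousOn
    · exact (differentiable_riemannZeta₁.continuous.comp continuous_ofReal).continuousOn
    · intro x hx; exact zeta1_ne_zero (by simpa using hx.1)
  obtain ⟨M, hM⟩ := isCompact_Icc.bddAbove_image hc
  refine ⟨max M 0, le_max_right _ _, fun σ h1 h2 => ?_⟩
  rw [VM_eq (by simpa using h1), sub_re]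
  have h3 : ‖deriv riemannZeta₁ σ / riemannZeta₁ σ‖ ≤ M := hM ⟨σ, ⟨h1.le, h2⟩, rfl⟩
  have h4 := (abs_le.mp (abs_re_le_norm (deriv riemannZeta₁ σ / riemannZeta₁ σ))).1
  have h5 : (1 / ((σ : ℂ) - 1)).re = 1 / (σ - 1) := by
    rw [← ofReal_one, ← ofReal_sub, ← ofReal_div, ofReal_re]
  rw [h5]
  have := le_max_left M 0
  linarith

lemma zeta1_lower : ∃ c : ℝ, 0 < c ∧ c ≤ 1 ∧ ∀ s : ℂ, 1 < s.re → s.re ≤ 3 → 1 ≤ |s.im| →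
    c * (s.re - 1) ≤ ‖riemannZeta₁ s‖ := by
  have hc : ContinuousOn (fun s : ℝ => ‖riemannZeta₁ s‖) (Icc 1 3) :=
    (differentiable_riemannZeta₁.continuous.comp continuous_ofReal).norm.continuousOn
  obtain ⟨M, hM⟩ := isCompact_Icc.bddAbove_image hc
  have hM1 : 1 ≤ M := by
    have := hM ⟨1, ⟨le_rfl, by norm_num⟩, rfl⟩
    simpa using this
  refine ⟨1 / M, by positivity, by rw [div_le_one (by linarith)]; exact hM1, fun s h1 h3 him => ?_⟩
  have hs1 : s ≠ 1 := by rintro rfl; simp at h1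
  have hσ : (1 : ℝ) < ((s.re : ℂ)).re := by simpa using h1
  have hσ1 : (s.re : ℂ) ≠ 1 := by intro h; rw [h] at hσ; simp at hσ
  have hz := ArithmeticFunction.LSeries_zeta_mul_Lseries_moebius h1
  rw [ArithmeticFunction.LSeries_zeta_eq_riemannZeta h1] at hz
  -- bound for the Moebius series
  have hsum := ArithmeticFunction.LSeriesSummable_moebius_iff.mpr h1
  have hsumz := ArithmeticFunction.LSeriesSummable_zeta_iff.mpr hσ
  have hmu : ‖LSeries (fun n => ((ArithmeticFunction.moebius n : ℤ) : ℂ)) s‖ ≤ ‖riemannZeta s.re‖ := by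
    rw [← ArithmeticFunction.LSeries_zeta_eq_riemannZeta hσ]
    have h7 : LSeries (fun n => ((ArithmeticFunction.zeta n : ℕ) : ℂ)) (s.re : ℂ) =
        ((∑' n, ‖LSeries.term (fun n => ((ArithmeticFunction.zeta n : ℕ) : ℂ)) (s.re : ℂ) n‖ : ℝ) : ℂ) := by
      rw [ofReal_tsum]
      refine tsum_congr fun n => ?_
      by_cases hn : n = 0
      · simp [hn]
      · rw [LSeries.norm_term_eq, LSeries.term_of_ne_zero hn]
        simp [hn, ofReal_cpow]
    rw [h7, norm_real, Real.norm_eq_abs, abs_of_nonneg (tsum_nonneg fun _ => norm_nonneg _)]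
    refine tsum_of_norm_bounded hsumz.norm.hasSum fun n => ?_
    by_cases hn : n = 0
    · simp [hn]
    · rw [LSeries.norm_term_eq, LSeries.norm_term_eq]
      simp only [hn, if_false, ofReal_re]
      gcongr
      have := ArithmeticFunction.abs_moebius_le_one (n := n)
      simp only [ArithmeticFunction.zeta_apply, hn, if_false]
      rw [norm_intCast]
      simpa using (by exact_mod_cast this : |((ArithmeticFunction.moebius n : ℤ) : ℝ)| ≤ 1)
  have hzr : ‖riemannZeta s.re‖ ≤ M / (s.re - 1) := by
    rw [riemannZeta_eq_inv_sub_mul hσ1, norm_mul, norm_inv, div_eq_inv_mul]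
    have h5 : ‖(s.re : ℂ) - 1‖ = s.re - 1 := by
      rw [← ofReal_one, ← ofReal_sub, norm_real, Real.norm_eq_abs, abs_of_pos (by linarith)]
    rw [h5]
    have hp : 0 < s.re - 1 := by linarith
    gcongr
    exact hM ⟨s.re, ⟨h1.le, h3⟩, rfl⟩
  have h6 : 1 ≤ ‖riemannZeta s‖ * (M / (s.re - 1)) := by
    calc (1 : ℝ) = ‖riemannZeta s‖ * ‖LSeries (fun n => ((ArithmeticFunction.moebius n : ℤ) : ℂ)) s‖ := by
          rw [← norm_mul, hz, norm_one]
      _ ≤ _ := by gcongr; exact hmu.trans hzr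
  have h8 : 1 ≤ ‖s - 1‖ := by
    have := abs_im_le_norm (s - 1)
    simp at this; linarith
  have h9 : ‖riemannZeta s‖ ≤ ‖riemannZeta₁ s‖ := by
    rw [zeta1_eq_mul hs1, norm_mul]
    nlinarith [norm_nonneg (riemannZeta s)]
  have hp : 0 < s.re - 1 := by linarith
  rw [← mul_div_assoc, le_div_iff₀ hp] at h6
  rw [one_div, inv_mul_le_iff₀ (by linarith)]
  nlinarith

end PNTAux


namespace PNTAux
open Complex Metric Set Filter Topology

/-- The logarithmic size of the height. -/
noncomputable def lg (t : ℝ) : ℝ := Real.log (|t| + 3)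

lemma one_le_lg (t : ℝ) : 1 ≤ lg t := by
  unfold lg
  rw [Real.le_log_iff_exp_le (by positivity)]
  linarith [Real.exp_one_lt_d9, abs_nonneg t]

lemma exp_lg (t : ℝ) : Real.exp (lg t) = |t| + 3 := by
  unfold lg; exact Real.exp_log (by positivity)

lemma lg_mono {s t : ℝ} (h : |s| ≤ |t|) : lg s ≤ lg t := by
  unfold lg; gcongr

lemma lg_two_mul (t : ℝ) : lg (2 * t) ≤ 2 * lg t := by
  unfold lg
  rw [← Real.log_rpow (by positivity)]
  have := abs_nonneg t
  apply Real.log_le_log (by positivity)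
  rw [abs_mul, abs_two, Real.rpow_two]
  nlinarith

lemma zeta1_ratio : ∃ B : ℝ, 0 ≤ B ∧ ∀ s : ℂ, 1 < s.re → s.re ≤ 2 → 1 ≤ |s.im| → ∀ z : ℂ, ‖z‖ ≤ 1 / 2 →
    ‖riemannZeta₁ (s + z)‖ ≤ ‖riemannZeta₁ s‖ *
      Real.exp (2 * lg s.im + Real.log (1 / (s.re - 1)) + B) := by
  obtain ⟨C, hC1, hC⟩ := zeta1_bound
  obtain ⟨c, hc0, hc1, hc⟩ := zeta1_lower
  have hCc : 1 ≤ 4 * C / c := by rw [le_div_iff₀ hc0]; linarith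
  refine ⟨Real.log (4 * C / c), Real.log_nonneg hCc, fun s h1 h2 him z hz => ?_⟩
  have hp : 0 < s.re - 1 := by linarith
  have hre : |z.re| ≤ 1 / 2 := (abs_re_le_norm z).trans hz
  have a1 := hC (s + z) (by simp only [add_re]; linarith [(abs_le.mp hre).1])
  have a2 := hc s h1 (by linarith) him
  have a3 : ‖s + z‖ ≤ |s.im| + 2 + 1 / 2 := by
    refine (norm_add_le _ _).trans ?_
    have := norm_le_abs_re_add_abs_im s
    rw [abs_of_pos (by linarith : 0 < s.re)] at this
    linarith
  rw [Real.exp_add, Real.exp_add, two_mul, Real.exp_add, exp_lg, Real.exp_log (by positivity),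
    Real.exp_log (by positivity)]
  have a4 : C * (1 + ‖s + z‖) ^ 2 ≤ 4 * C * ((|s.im| + 3) * (|s.im| + 3)) := by
    have : 1 + ‖s + z‖ ≤ 2 * (|s.im| + 3) := by linarith [abs_nonneg s.im]
    calc C * (1 + ‖s + z‖) ^ 2 ≤ C * (2 * (|s.im| + 3)) ^ 2 := by gcongr
      _ = _ := by ring
  refine (a1.trans a4).trans ?_
  calc 4 * C * ((|s.im| + 3) * (|s.im| + 3))
      = c * (s.re - 1) * ((|s.im| + 3) * (|s.im| + 3) * (1 / (s.re - 1)) * (4 * C / c)) := by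
        field_simp
    _ ≤ _ := by gcongr

lemma zero_free : ∃ c : ℝ, 0 < c ∧ c ≤ 1 / 4 ∧ ∀ s : ℂ, riemannZeta₁ s = 0 → 1 ≤ |s.im| →
    s.re ≤ 1 - c / lg s.im := by
  obtain ⟨B, hB0, hB⟩ := zeta1_ratio
  obtain ⟨M, hM0, hM⟩ := VM_real_bound
  set K : ℝ := 3 * M + 13 + 1152 + 480 * B + 480 * Real.log 2000 with hK
  have hlog : 0 ≤ Real.log 2000 := Real.log_nonneg (by norm_num)
  have hK4 : 1000 ≤ K := by linarith
  refine ⟨1 / (28 * K), by positivity, ?_, fun s hs him => ?_⟩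
  · rw [div_le_div_iff₀ (by positivity) (by norm_num)]; linarith
  set l := lg s.im with hl
  have hl1 : 1 ≤ l := one_le_lg _
  set η : ℝ := 1 / (4 * K * l) with hη
  have hη0 : 0 < η := by positivity
  have hKl : 1000 ≤ K * l := by nlinarith
  have hη4 : η ≤ 1 / 4000 := by
    rw [hη, div_le_div_iff₀ (by positivity) (by norm_num)]; linarith
  have hηinv : 1 / η = 4 * K * l := by rw [hη, one_div_one_div]
  have hgoal : 1 / (28 * K) / l = η / 7 := by rw [hη]; field_simp; norm_num
  rw [hgoal]
  have hβ : s.re < 1 := by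
    by_contra h
    exact zeta1_ne_zero (not_lt.mp h) hs
  by_cases hb : 1 / 4 ≤ 1 - s.re
  · linarith
  push Not at hb
  set d : ℝ := η + (1 - s.re) with hd
  have hd0 : 0 < d := by linarith
  have hd2 : d < 1 / 2 := by linarith
  have hzz : ∀ w : ℂ, w.re = 1 + η → ∀ z ∈ ball (0 : ℂ) (1 / 4), riemannZeta₁ (w + z) = 0 → z.re ≤ 0 := by
    intro w hw z _ h
    by_contra hz
    push Not at hz
    refine zeta1_ne_zero ?_ h
    rw [add_re, hw]; linarith
  have hLe : Real.log (1 / η) ≤ (1 / η) / 2000 + Real.log 2000 := by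
    have := Real.log_le_sub_one_of_pos (show 0 < (1 / η) / 2000 by positivity)
    rw [Real.log_div (by positivity) (by norm_num)] at this
    linarith
  have hL0 : 0 ≤ Real.log (1 / η) := by
    apply Real.log_nonneg; rw [hηinv]; linarith
  -- first point
  set w1 : ℂ := ((1 + η : ℝ) : ℂ) + (s.im : ℝ) * I with hw1
  have w1re : w1.re = 1 + η := by simp [hw1]
  have w1im : w1.im = s.im := by simp [hw1]
  set w2 : ℂ := ((1 + η : ℝ) : ℂ) + (2 * s.im : ℝ) * I with hw2
  have w2re : w2.re = 1 + η := by simp [hw2]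
  have w2im : w2.im = 2 * s.im := by simp [hw2]
  have dif : ∀ w : ℂ, Differentiable ℂ (fun z => riemannZeta₁ (w + z)) := fun w =>
    differentiable_riemannZeta₁.comp (differentiable_id.const_add w)
  have e1 : s = w1 + (-(d : ℂ)) := by
    apply Complex.ext
    · simp [w1re, hd]; ring
    · simp [w1im]
  have b1 := neg_re_logDeriv_le_one (f := fun z => riemannZeta₁ (w1 + z)) (r := 1 / 4) (R := 1 / 2)
    (L := 2 * l + Real.log (1 / η) + B) (d := d)
    (by norm_num) (by norm_num) (by positivity) (dif w1) ?_ ?_ (hzz w1 w1re) hd0 hd2 ?_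
  rotate_left
  · intro z hz
    have := hB w1 (by linarith) (by linarith) (by rw [w1im]; exact him) z (by simp at hz; rw [hz]; norm_num)
    rw [w1re, w1im, add_sub_cancel_left] at this
    simpa using this
  · simpa using zeta1_ne_zero (s := w1) (by linarith)
  · rw [← e1]; exact hs
  have him2 : |s.im| ≤ |2 * s.im| := by rw [abs_mul, abs_two]; linarith [abs_nonneg s.im]
  have hl2 : lg (2 * s.im) ≤ 2 * l := lg_two_mul _
  have hl20 := one_le_lg (2 * s.im)
  have b2 := neg_re_logDeriv_le' (f := fun z => riemannZeta₁ (w2 + z)) (r := 1 / 4) (R := 1 / 2)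
    (L := 2 * lg (2 * s.im) + Real.log (1 / η) + B)
    (by norm_num) (by norm_num) (by positivity) (dif w2) ?_ ?_ (hzz w2 w2re)
  rotate_left
  · intro z hz
    have := hB w2 (by linarith) (by linarith) (by rw [w2im]; linarith) z (by simp at hz; rw [hz]; norm_num)
    rw [w2re, w2im, add_sub_cancel_left] at this
    simpa using this
  · simpa using zeta1_ne_zero (s := w2) (by linarith)
  simp only [deriv_comp_const_add, add_zero] at b1 b2
  have b3 := hM (1 + η) (by linarith) (by linarith)
  rw [add_sub_cancel_left] at b3
  have hinv : ∀ w : ℂ, 1 ≤ |w.im| → (1 / (w - 1)).re ≤ 1 := by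
    intro w hw
    refine (re_le_norm _).trans ?_
    rw [norm_div, norm_one]
    have := abs_im_le_norm (w - 1)
    simp only [sub_im, one_im, sub_zero] at this
    rw [div_le_one (by linarith)]; linarith
  have c1 : (VM w1).re ≤ 1 + (-(deriv riemannZeta₁ w1 / riemannZeta₁ w1)).re := by
    rw [VM_eq (by linarith), sub_re, neg_re]
    linarith [hinv w1 (by rw [w1im]; exact him)]
  have c2 : (VM w2).re ≤ 1 + (-(deriv riemannZeta₁ w2 / riemannZeta₁ w2)).re := by
    rw [VM_eq (by linarith), sub_re, neg_re]
    linarith [hinv w2 (by rw [w2im]; linarith)]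
  have c3 := three_four_one (show 1 < 1 + η by linarith) s.im
  rw [← hw1, ← hw2] at c3
  have hfin : 4 / d ≤ (7 / 2) / η := by
    have q1 : 4 / d = 4 * (1 / d) := by ring
    have q2 : (7 / 2) / η = (7 / 2) * (1 / η) := by ring
    rw [q1, q2]
    have q3 : K ≤ K * l := by nlinarith
    have q4 : 3 * M + 13 + 480 * B + 480 * Real.log 2000 ≤ (3 * M + 13 + 480 * B + 480 * Real.log 2000) * l := by
      nlinarith
    have q5 : K * l = (3 * M + 13 + 480 * B + 480 * Real.log 2000) * l + 1152 * l := by rw [hK]; ring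
    clear_value η d l w1 w2
    generalize Real.log (1 / η) = u at *
    generalize (1 / η) = x at *
    generalize (1 / d) = y at *
    generalize (-(deriv riemannZeta₁ w1 / riemannZeta₁ w1)).re = v1 at *
    generalize (-(deriv riemannZeta₁ w2 / riemannZeta₁ w2)).re = v2 at *
    generalize Real.log 2000 = q at *
    have b1' : v1 ≤ 96 * (2 * l + u + B) - y + 2 := by norm_num at b1; linarith
    have b2' : v2 ≤ 96 * (4 * l + u + B) := by norm_num at b2; linarith
    have b4 : 4 * y ≤ 3 * x + 3 * M + 13 + 96 * (4 * (2 * l + u + B)) + 96 * (4 * l + u + B) := by linarith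
    have b5 : 4 * y ≤ 3 * x + 3 * M + 13 + 1152 * l + 480 * B + 480 * (x / 2000 + q) := by linarith
    linarith
  rw [div_le_div_iff₀ hd0 hη0] at hfin
  linarith

end PNTAux


namespace PNTAux
open Complex Metric Set Filter Topology

lemma logDeriv_high : ∃ c : ℝ, 0 < c ∧ ∃ B : ℝ, 0 ≤ B ∧ ∀ w : ℂ, 2 ≤ |w.im| → 1 - c / lg w.im ≤ w.re →
    w.re ≤ 3 / 2 → riemannZeta₁ w ≠ 0 ∧ ‖deriv riemannZeta₁ w / riemannZeta₁ w‖ ≤ B * lg w.im ^ 2 := by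
  obtain ⟨c, hc0, hc4, hc⟩ := zero_free
  obtain ⟨B, hB0, hB⟩ := zeta1_ratio
  refine ⟨c / 16, by positivity, 24 * (2 + 16 / c + B) * 4 / c, by positivity, fun w him hre hre2 => ?_⟩
  set l := lg w.im with hl
  have hl1 : 1 ≤ l := one_le_lg _
  set r : ℝ := c / (4 * l) with hr
  have hr0 : 0 < r := by positivity
  have hr1 : r ≤ 1 / 16 := by
    rw [hr, div_le_iff₀ (by positivity)]; linarith
  have hre' : 1 - r / 4 ≤ w.re := by
    have : c / 16 / l = r / 4 := by rw [hr]; field_simp; norm_num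
    rw [← this]; exact hre
  set z₀ : ℂ := w + ((r / 2 : ℝ) : ℂ) with hz0
  have z0re : z₀.re = w.re + r / 2 := by simp [hz0]
  have z0im : z₀.im = w.im := by simp [hz0]
  have hnz : ∀ z : ℂ, ‖z‖ < r → riemannZeta₁ (z₀ + z) ≠ 0 := by
    intro z hz h0
    have i1 := (abs_im_le_norm z).trans hz.le
    have i2 := (abs_re_le_norm z).trans hz.le
    have i3 : |(z₀ + z).im| ≤ |w.im| + r := by
      rw [add_im, z0im]; exact (abs_add_le _ _).trans (by linarith)
    have i4 : |w.im| - r ≤ |(z₀ + z).im| := by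
      rw [add_im, z0im]
      have := abs_sub_abs_le_abs_sub w.im (-z.im)
      rw [abs_neg, sub_neg_eq_add] at this; linarith
    have i5 := hc (z₀ + z) h0 (by linarith)
    have i6 : lg (z₀ + z).im ≤ 2 * l := by
      refine (lg_mono (t := 2 * w.im) ?_).trans (lg_two_mul _)
      rw [abs_mul, abs_two]; linarith
    have i7 : 2 * r ≤ c / lg (z₀ + z).im := by
      have : 2 * r = c / (2 * l) := by rw [hr]; field_simp; norm_num
      rw [this]
      have := one_le_lg (z₀ + z).im
      gcongr
    rw [add_re, z0re] at i5
    linarith [(abs_le.mp i2).1]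
  have hL : ∀ z ∈ ball (0 : ℂ) r, ‖riemannZeta₁ (z₀ + z)‖ ≤ ‖riemannZeta₁ (z₀ + 0)‖ *
      Real.exp ((2 + 16 / c + B) * l) := by
    intro z hz
    rw [mem_ball_zero_iff] at hz
    rw [add_zero]
    refine (hB z₀ (by linarith) (by linarith) (by rw [z0im]; linarith) z (by linarith)).trans ?_
    gcongr
    rw [z0im, ← hl]
    have h1 : Real.log (1 / (z₀.re - 1)) ≤ 16 / c * l := by
      have h2 : 1 / (z₀.re - 1) ≤ 16 / c * l := by
        have h3 : r / 4 ≤ z₀.re - 1 := by linarith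
        calc 1 / (z₀.re - 1) ≤ 1 / (r / 4) := by gcongr
          _ = _ := by rw [hr]; field_simp; norm_num
      have h4 : 0 < 1 / (z₀.re - 1) := by
        have : 0 < z₀.re - 1 := by linarith
        positivity
      linarith [Real.log_le_sub_one_of_pos h4]
    nlinarith
  have key := logDeriv_bound (f := fun z => riemannZeta₁ (z₀ + z)) (r := r)
    (L := (2 + 16 / c + B) * l) (w := -((r / 2 : ℝ) : ℂ))
    (differentiable_riemannZeta₁.comp (differentiable_id.const_add z₀)) hr0 (by positivity)
    (fun z hz => hnz z (by simpa using hz)) hL (by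
      rw [norm_neg, norm_real, Real.norm_eq_abs, abs_of_pos (by positivity)])
  have e : z₀ + -((r / 2 : ℝ) : ℂ) = w := by rw [hz0]; ring
  simp only [deriv_comp_const_add, e] at key
  refine ⟨?_, key.trans (le_of_eq ?_)⟩
  · have := hnz (-((r / 2 : ℝ) : ℂ)) (by
      rw [norm_neg, norm_real, Real.norm_eq_abs, abs_of_pos (by positivity)]; linarith)
    rwa [e] at this
  · rw [hr]; field_simp

lemma logDeriv_low : ∃ c : ℝ, 0 < c ∧ ∃ B : ℝ, 0 ≤ B ∧ ∀ w : ℂ, |w.im| ≤ 2 → 1 - c ≤ w.re →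
    w.re ≤ 3 / 2 → riemannZeta₁ w ≠ 0 ∧ ‖deriv riemannZeta₁ w / riemannZeta₁ w‖ ≤ B := by
  have hcomp : ∀ a : ℝ, IsCompact (Icc a (3 / 2) ×ℂ Icc (-2 : ℝ) 2) := fun a =>
    isCompact_Icc.reProdIm isCompact_Icc
  have hnz : ∃ c : ℝ, 0 < c ∧ ∀ w : ℂ, |w.im| ≤ 2 → 1 - c ≤ w.re → w.re ≤ 3 / 2 → riemannZeta₁ w ≠ 0 := by
    set Z : Set ℂ := (Icc 0 (3 / 2) ×ℂ Icc (-2 : ℝ) 2) ∩ {w | riemannZeta₁ w = 0} with hZ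
    have hZc : IsCompact Z := (hcomp 0).inter_right
      (isClosed_eq differentiable_riemannZeta₁.continuous continuous_const)
    rcases Z.eq_empty_or_nonempty with hE | hne
    · refine ⟨1, one_pos, fun w h1 h2 h3 h0 => ?_⟩
      have : w ∈ Z := ⟨⟨⟨by linarith, h3⟩, abs_le.mp h1⟩, h0⟩
      rw [hE] at this; exact this
    · obtain ⟨z, hz, hmax⟩ := hZc.exists_isMaxOn hne continuous_re.continuousOn
      have hz1 : z.re < 1 := by
        by_contra h
        exact zeta1_ne_zero (not_lt.mp h) hz.2
      have hz0 : 0 ≤ z.re := hz.1.1.1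
      refine ⟨(1 - z.re) / 2, by linarith, fun w h1 h2 h3 h0 => ?_⟩
      have : w ∈ Z := ⟨⟨⟨by linarith, h3⟩, abs_le.mp h1⟩, h0⟩
      have := hmax this
      change w.re ≤ z.re at this
      linarith
  obtain ⟨c, hc0, hc⟩ := hnz
  have hcont : ContinuousOn (fun w => ‖deriv riemannZeta₁ w / riemannZeta₁ w‖)
      (Icc (1 - c) (3 / 2) ×ℂ Icc (-2 : ℝ) 2) := by
    refine ContinuousOn.norm (ContinuousOn.div ?_ ?_ ?_)
    · exact differentiable_riemannZeta₁.deriv.continuous.continuousOn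
    · exact differentiable_riemannZeta₁.continuous.continuousOn
    · intro w hw
      exact hc w (abs_le.mpr hw.2) hw.1.1 hw.1.2
  obtain ⟨B, hB⟩ := (hcomp (1 - c)).bddAbove_image hcont
  refine ⟨c, hc0, max B 0, le_max_right _ _, fun w h1 h2 h3 => ⟨hc w h1 h2 h3, ?_⟩⟩
  exact (hB ⟨w, ⟨⟨h2, h3⟩, abs_le.mp h1⟩, rfl⟩).trans (le_max_left _ _)

/-- The regularised logarithmic derivative. -/
noncomputable def HH (w : ℂ) : ℂ := Real.eulerMascheroniConstant - deriv riemannZeta₁ w / riemannZeta₁ w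

lemma HH_one : HH 1 = 0 := by
  simp [HH, deriv_riemannZeta₁_one]

lemma HH_diff {w : ℂ} (h : riemannZeta₁ w ≠ 0) : DifferentiableAt ℂ HH w := by
  unfold HH
  exact (DifferentiableAt.div (differentiable_riemannZeta₁.deriv w) (differentiable_riemannZeta₁ w) h).const_sub _

lemma HH_bound : ∃ c : ℝ, 0 < c ∧ c ≤ 1 / 4 ∧ ∃ B : ℝ, 0 < B ∧ ∀ w : ℂ, 1 - c / lg w.im ≤ w.re →
    w.re ≤ 3 / 2 → riemannZeta₁ w ≠ 0 ∧ ‖HH w‖ ≤ B * lg w.im ^ 2 := by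
  obtain ⟨c1, hc1, B1, hB1, h1⟩ := logDeriv_high
  obtain ⟨c2, hc2, B2, hB2, h2⟩ := logDeriv_low
  set g := ‖(Real.eulerMascheroniConstant : ℂ)‖
  refine ⟨min (1 / 4) (min c1 c2), by positivity, min_le_left _ _, g + B1 + B2 + 1, by positivity,
    fun w ha hb => ?_⟩
  have hl1 := one_le_lg w.im
  have hl2 : 1 ≤ lg w.im ^ 2 := one_le_pow₀ hl1
  have hg : 0 ≤ g := norm_nonneg _
  suffices riemannZeta₁ w ≠ 0 ∧ ‖deriv riemannZeta₁ w / riemannZeta₁ w‖ ≤ (B1 + B2) * lg w.im ^ 2 by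
    refine ⟨this.1, (norm_sub_le _ _).trans ?_⟩
    have := this.2
    nlinarith
  rcases le_total 2 |w.im| with h | h
  · have hx : 1 - c1 / lg w.im ≤ w.re := by
      refine le_trans ?_ ha
      gcongr
      exact (min_le_right _ _).trans (min_le_left _ _)
    obtain ⟨ha1, ha2⟩ := h1 w h hx hb
    exact ⟨ha1, ha2.trans (by nlinarith)⟩
  · have hx : 1 - c2 ≤ w.re := by
      refine le_trans ?_ ha
      gcongr
      refine le_trans (div_le_self (by positivity) hl1) ?_
      exact (min_le_right _ _).trans (min_le_right _ _)
    obtain ⟨ha1, ha2⟩ := h2 w h hx hb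
    exact ⟨ha1, ha2.trans (by nlinarith)⟩

end PNTAux


namespace PNTAux
open Complex Metric Set Filter Topology MeasureTheory

/-- Indicator of the unit interval. -/
noncomputable def i1 : ℝ → ℂ := indicator (Ioc 0 1) (fun _ => 1 : ℝ → ℂ)
/-- The identity cut off to the unit interval. -/
noncomputable def ix : ℝ → ℂ := indicator (Ioc 0 1) (fun t => (t : ℂ) ^ (1 : ℂ) : ℝ → ℂ)

lemma i1_of_mem {x : ℝ} (h0 : 0 < x) (h1 : x ≤ 1) : i1 x = 1 := indicator_of_mem (show x ∈ Ioc 0 1 from ⟨h0, h1⟩) _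
lemma i1_of_gt {x : ℝ} (h1 : 1 < x) : i1 x = 0 := indicator_of_notMem (fun h => not_lt.mpr h.2 h1) _
lemma ix_of_mem {x : ℝ} (h0 : 0 < x) (h1 : x ≤ 1) : ix x = x := by
  unfold ix; rw [indicator_of_mem (show x ∈ Ioc 0 1 from ⟨h0, h1⟩)]; simp
lemma ix_of_gt {x : ℝ} (h1 : 1 < x) : ix x = 0 := indicator_of_notMem (fun h => not_lt.mpr h.2 h1) _

lemma mel_phi {s : ℂ} (hs : 0 < s.re) : HasMellin (fun t => i1 t - ix t) s (1 / (s * (s + 1))) := by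
  have h1 : HasMellin i1 s (1 / s) := hasMellin_one_Ioc hs
  have h2 : HasMellin ix s (1 / (s + 1)) := hasMellin_cpow_Ioc 1 (by simp; linarith)
  have h3 := hasMellin_sub h1.1 h2.1
  rw [h1.2, h2.2] at h3
  have hs0 : s ≠ 0 := by rintro rfl; simp at hs
  have hs1 : s + 1 ≠ 0 := by intro h; have := congrArg re h; simp at this; linarith
  have e : 1 / s - 1 / (s + 1) = 1 / (s * (s + 1)) := by field_simp; ring
  rwa [e] at h3

lemma mel_log {s : ℂ} (hs : 0 < s.re) : HasMellin (fun t => Real.log t • i1 t) s (-(1 / s ^ 2)) := by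
  have hs0 : s ≠ 0 := by rintro rfl; simp at hs
  have hInt : LocallyIntegrableOn i1 (Ioi 0) := by
    refine (Integrable.locallyIntegrable ?_).locallyIntegrableOn _
    unfold i1
    rw [integrable_indicator_iff measurableSet_Ioc]
    exact integrableOn_const (by simp)
  have ht : i1 =O[atTop] (fun x : ℝ => x ^ (-(s.re + 1))) := by
    refine Asymptotics.IsBigO.congr' (Asymptotics.isBigO_zero _ _) ?_ EventuallyEq.rfl
    filter_upwards [eventually_gt_atTop 1] with x hx
    exact (i1_of_gt hx).symm
  have hb : i1 =O[𝓝[>] 0] (fun x : ℝ => x ^ (-(0 : ℝ))) := by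
    refine Asymptotics.IsBigO.of_bound 1 (Eventually.of_forall fun x => ?_)
    unfold i1 indicator
    split_ifs <;> simp
  obtain ⟨h1, h2⟩ := mellin_hasDerivAt_of_isBigO_rpow hInt ht (by linarith) hb hs
  refine ⟨h1, ?_⟩
  have h3 : mellin i1 =ᶠ[𝓝 s] fun z => z⁻¹ := by
    filter_upwards [(isOpen_lt continuous_const continuous_re).mem_nhds hs] with z hz
    rw [← one_div]
    exact (hasMellin_one_Ioc hz).2
  have h4 := (hasDerivAt_inv hs0).congr_of_eventuallyEq h3
  rw [h2.unique h4, one_div]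

lemma mel_g {s : ℂ} (hs : 0 < s.re) :
    HasMellin (fun t => ix t - i1 t - Real.log t • i1 t) s (1 / (s * (s + 1)) / s) := by
  have h1 : HasMellin i1 s (1 / s) := hasMellin_one_Ioc hs
  have h2 : HasMellin ix s (1 / (s + 1)) := hasMellin_cpow_Ioc 1 (by simp; linarith)
  have h3 := hasMellin_sub h2.1 h1.1
  have h4 := hasMellin_sub h3.1 (mel_log hs).1
  rw [(mel_log hs).2, h3.2, h1.2, h2.2] at h4
  have hs0 : s ≠ 0 := by rintro rfl; simp at hs
  have hs1 : s + 1 ≠ 0 := by intro h; have := congrArg re h; simp at this; linarith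
  have e : 1 / (s + 1) - 1 / s - -(1 / s ^ 2) = 1 / (s * (s + 1)) / s := by field_simp; ring
  rwa [e] at h4

/-- The Perron kernel. -/
noncomputable def kr (s : ℂ) : ℂ := 1 / (s * (s + 1))

lemma kr_bound {a : ℝ} (ha0 : a ≠ 0) (ha : |a| ≤ 1 / 2) (y : ℝ) :
    ‖kr (a + y * I)‖ ≤ 4 / |a| * (1 + y ^ 2)⁻¹ := by
  have hp : 0 < |a| := abs_pos.mpr ha0
  unfold kr
  rw [norm_div, norm_one, norm_mul, ← one_div, div_mul_div_comm, mul_one]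
  have q1 : |a| ≤ ‖(a : ℂ) + y * I‖ := by
    have := abs_re_le_norm ((a : ℂ) + y * I); simpa using this
  have q2 : |y| ≤ ‖(a : ℂ) + y * I‖ := by
    have := abs_im_le_norm ((a : ℂ) + y * I); simpa using this
  have q3 : 1 / 2 ≤ ‖(a : ℂ) + y * I + 1‖ := by
    have := abs_re_le_norm ((a : ℂ) + y * I + 1)
    simp at this
    have h2 := le_abs_self (a + 1)
    linarith [(abs_le.mp ha).1]
  have q4 : |y| ≤ ‖(a : ℂ) + y * I + 1‖ := by
    have := abs_im_le_norm ((a : ℂ) + y * I + 1); simpa using this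
  have hpos : 0 < ‖(a : ℂ) + y * I‖ * ‖(a : ℂ) + y * I + 1‖ := by
    apply mul_pos <;> linarith
  rw [div_le_div_iff₀ hpos (by positivity), one_mul]
  rcases le_total |y| 1 with h | h
  · have : y ^ 2 ≤ 1 := by rw [← sq_abs]; nlinarith [abs_nonneg y]
    have h5 : |a| * (1 / 2) ≤ ‖(a : ℂ) + y * I‖ * ‖(a : ℂ) + y * I + 1‖ := by gcongr
    nlinarith
  · have h6 : y ^ 2 = |y| * |y| := by rw [← sq_abs]; ring
    have h5 : |y| * |y| ≤ ‖(a : ℂ) + y * I‖ * ‖(a : ℂ) + y * I + 1‖ := by gcongr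
    rw [h6]
    nlinarith

lemma ne_zero_of_re {s : ℂ} (h : 0 < s.re) : s ≠ 0 := by rintro rfl; simp at h

lemma kr_cont {a : ℝ} (ha : 0 < a) : Continuous (fun y : ℝ => kr (a + y * I)) := by
  unfold kr
  refine Continuous.div continuous_const (by fun_prop) fun y => mul_ne_zero ?_ ?_
  · exact ne_zero_of_re (by simpa using ha)
  · exact ne_zero_of_re (by simp; linarith)

lemma kr_int {a : ℝ} (ha : 0 < a) (ha2 : a ≤ 1 / 2) : Integrable (fun y : ℝ => kr (a + y * I)) := by
  refine (integrable_inv_one_add_sq.const_mul (4 / |a|)).mono' (kr_cont ha).aestronglyMeasurable ?_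
  exact Eventually.of_forall fun y => kr_bound ha.ne' (by rwa [abs_of_pos ha]) y

lemma kr_div_int {a : ℝ} (ha : 0 < a) (ha2 : a ≤ 1 / 2) :
    Integrable (fun y : ℝ => kr (a + y * I) / (a + y * I)) := by
  have hc : Continuous (fun y : ℝ => kr (a + y * I) / (a + y * I)) :=
    (kr_cont ha).div (by fun_prop) fun y => ne_zero_of_re (by simpa using ha)
  refine ((kr_int ha ha2).norm.const_mul (1 / a)).mono' hc.aestronglyMeasurable ?_
  refine Eventually.of_forall fun y => ?_
  rw [norm_div, div_eq_inv_mul, one_div]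
  gcongr
  have := abs_re_le_norm ((a : ℂ) + y * I)
  simp at this
  exact (le_abs_self a).trans this

lemma perron1 {a x : ℝ} (ha : 0 < a) (ha2 : a ≤ 1 / 2) (hx : 0 < x) :
    ∫ y : ℝ, (x : ℂ) ^ (-((a : ℂ) + y * I)) * kr (a + y * I) = 2 * Real.pi * ((max (1 - x) 0 : ℝ) : ℂ) := by
  have e : ∀ y : ℝ, mellin (fun t => i1 t - ix t) (a + y * I) = kr (a + y * I) := fun y =>
    (mel_phi (s := a + y * I) (by simpa using ha)).2
  have ev : ∀ t : ℝ, 0 < t → i1 t - ix t = ((max (1 - t) 0 : ℝ) : ℂ) := by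
    intro t ht
    rcases le_or_gt t 1 with h | h
    · rw [i1_of_mem ht h, ix_of_mem ht h, max_eq_left (by linarith)]; simp
    · rw [i1_of_gt h, ix_of_gt h, max_eq_right (by linarith)]; simp
  have := mellinInv_mellin_eq a (fun t => i1 t - ix t) hx (mel_phi (s := a) (by simpa using ha)).1 ?_ ?_
  · rw [← ev x hx, ← this]
    unfold mellinInv
    simp_rw [e, smul_eq_mul]
    rw [real_smul, ← mul_assoc]
    have : (2 : ℂ) * Real.pi * ((1 / (2 * Real.pi) : ℝ) : ℂ) = 1 := by
      have := Real.pi_ne_zero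
      push_cast
      field_simp
    rw [this, one_mul]
  · unfold Complex.VerticalIntegrable
    simp_rw [e]; exact kr_int ha ha2
  · have hc : ContinuousAt (fun t : ℝ => ((max (1 - t) 0 : ℝ) : ℂ)) x := by fun_prop
    refine hc.congr ?_
    filter_upwards [lt_mem_nhds hx] with t ht using (ev t ht).symm

lemma perron2 {a x : ℝ} (ha : 0 < a) (ha2 : a ≤ 1 / 2) (hx : 0 < x) (hx1 : x < 1) :
    ∫ y : ℝ, (x : ℂ) ^ (-((a : ℂ) + y * I)) * (kr (a + y * I) / (a + y * I)) =
      2 * Real.pi * ((x - 1 - Real.log x : ℝ) : ℂ) := by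
  have e : ∀ y : ℝ, mellin (fun t => ix t - i1 t - Real.log t • i1 t) (a + y * I) = kr (a + y * I) / (a + y * I) := fun y =>
    (mel_g (s := a + y * I) (by simpa using ha)).2
  have ev : ∀ t : ℝ, 0 < t → t < 1 → ix t - i1 t - Real.log t • i1 t = ((t - 1 - Real.log t : ℝ) : ℂ) := by
    intro t ht h
    rw [i1_of_mem ht h.le, ix_of_mem ht h.le]; simp
  have := mellinInv_mellin_eq a (fun t => ix t - i1 t - Real.log t • i1 t) hx (mel_g (s := a) (by simpa using ha)).1 ?_ ?_
  · rw [← ev x hx hx1, ← this]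
    unfold mellinInv
    simp_rw [e, smul_eq_mul]
    rw [real_smul, ← mul_assoc]
    have : (2 : ℂ) * Real.pi * ((1 / (2 * Real.pi) : ℝ) : ℂ) = 1 := by
      have := Real.pi_ne_zero
      push_cast
      field_simp
    rw [this, one_mul]
  · unfold Complex.VerticalIntegrable
    simp_rw [e]; exact kr_div_int ha ha2
  · have hc : ContinuousAt (fun t : ℝ => ((t - 1 - Real.log t : ℝ) : ℂ)) x := by
      refine continuous_ofReal.continuousAt.comp ?_
      exact (by fun_prop : ContinuousAt (fun t : ℝ => t - 1) x).sub (Real.continuousAt_log hx.ne')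
    refine hc.congr ?_
    filter_upwards [lt_mem_nhds hx, gt_mem_nhds hx1] with t ht ht1 using (ev t ht ht1).symm

end PNTAux


namespace PNTAux
open Complex Metric Set Filter Topology MeasureTheory

/-- The smoothed sum of von Mangoldt. -/
noncomputable def TT (X : ℝ) : ℝ :=
  ∑ n ∈ Finset.Icc 1 ⌊X⌋₊, ArithmeticFunction.vonMangoldt n / n * (1 - n / X)

lemma cpow_line_cont {x : ℝ} (hx : 0 < x) (a : ℝ) : Continuous (fun y : ℝ => (x : ℂ) ^ ((a : ℂ) + y * I)) := by
  refine Continuous.const_cpow (by fun_prop) (Or.inl ?_)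
  exact_mod_cast hx.ne'

lemma norm_cpow_line {x : ℝ} (hx : 0 < x) (a y : ℝ) : ‖(x : ℂ) ^ ((a : ℂ) + y * I)‖ = x ^ a := by
  rw [norm_cpow_eq_rpow_re_of_pos hx]; simp

lemma cpow_mul_int {x a : ℝ} (hx : 0 < x) {f : ℝ → ℂ} (hf : Integrable f) :
    Integrable (fun y : ℝ => (x : ℂ) ^ ((a : ℂ) + y * I) * f y) := by
  refine hf.bdd_mul (c := x ^ a) (cpow_line_cont hx a).aestronglyMeasurable ?_
  exact Eventually.of_forall fun y => (norm_cpow_line hx a y).le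

lemma cpow_div_neg {n X : ℝ} (hn : 0 < n) (hX : 0 < X) (s : ℂ) :
    ((n / X : ℝ) : ℂ) ^ (-s) = (X : ℂ) ^ s * (n : ℂ) ^ (-s) := by
  have h := Complex.mul_cpow_ofReal_nonneg (div_pos hn hX).le hX.le s
  rw [← ofReal_mul, div_mul_cancel₀ _ hX.ne'] at h
  have h0 : ((n / X : ℝ) : ℂ) ≠ 0 := by exact_mod_cast (div_pos hn hX).ne'
  have h1 : (X : ℂ) ≠ 0 := by exact_mod_cast hX.ne'
  rw [cpow_neg, cpow_neg, h]
  have h2 : ((n / X : ℝ) : ℂ) ^ s ≠ 0 := by rw [Ne, cpow_eq_zero_iff]; tauto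
  have h3 : (X : ℂ) ^ s ≠ 0 := by rw [Ne, cpow_eq_zero_iff]; tauto
  field_simp

lemma perron_sum {a X : ℝ} (ha : 0 < a) (ha2 : a ≤ 1 / 2) (hX : 0 < X) :
    ∫ y : ℝ, VM (1 + ((a : ℂ) + y * I)) * ((X : ℂ) ^ ((a : ℂ) + y * I) * kr (a + y * I)) =
      2 * Real.pi * (TT X : ℂ) := by
  set v : ℕ → ℂ := fun n => (ArithmeticFunction.vonMangoldt n : ℂ) with hv
  set F : ℕ → ℝ → ℂ := fun n y => LSeries.term v (1 + ((a : ℂ) + y * I)) n *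
    ((X : ℂ) ^ ((a : ℂ) + y * I) * kr (a + y * I)) with hF
  have hF0 : F 0 = 0 := by ext y; simp [hF]
  have hFn : ∀ n : ℕ, n ≠ 0 → F n = fun y : ℝ => (v n / n) *
      (((n / X : ℝ) : ℂ) ^ (-((a : ℂ) + y * I)) * kr (a + y * I)) := by
    intro n hn
    ext y
    have hn' : (n : ℂ) ≠ 0 := by exact_mod_cast hn
    have hnp : (0 : ℝ) < n := by exact_mod_cast Nat.pos_of_ne_zero hn
    simp only [hF]
    rw [LSeries.term_of_ne_zero hn, cpow_div_neg hnp hX, cpow_add _ _ hn', cpow_one, cpow_neg, ofReal_natCast]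
    field_simp
  have hInt : ∀ n, Integrable (F n) := by
    intro n
    rcases eq_or_ne n 0 with rfl | hn
    · rw [hF0]; exact integrable_zero _ _ _
    · rw [hFn n hn]
      have hnp : (0 : ℝ) < n := by exact_mod_cast Nat.pos_of_ne_zero hn
      refine Integrable.const_mul ?_ _
      have hp : 0 < n / X := div_pos hnp hX
      refine (kr_int ha ha2).bdd_mul (c := (n / X) ^ (-a)) ?_ ?_
      · refine Continuous.aestronglyMeasurable ?_
        refine Continuous.const_cpow (by fun_prop) (Or.inl ?_)
        exact_mod_cast hp.ne'
      · refine Eventually.of_forall fun y => le_of_eq ?_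
        rw [norm_cpow_eq_rpow_re_of_pos hp]; simp
  have hnorm : ∀ n, ∫ y, ‖F n y‖ = ‖LSeries.term v (1 + (a : ℂ)) n‖ * (X ^ a * ∫ y : ℝ, ‖kr (a + y * I)‖) := by
    intro n
    have : ∀ y : ℝ, ‖F n y‖ = ‖LSeries.term v (1 + (a : ℂ)) n‖ * (X ^ a * ‖kr (a + y * I)‖) := by
      intro y
      simp only [hF]
      rw [norm_mul, norm_mul, norm_cpow_line hX, LSeries.norm_term_eq, LSeries.norm_term_eq]
      simp
    simp_rw [this]
    rw [integral_const_mul, integral_const_mul]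
  have hsum : Summable (fun n => ∫ y, ‖F n y‖) := by
    simp_rw [hnorm]
    refine Summable.mul_right _ ?_
    exact (ArithmeticFunction.LSeriesSummable_vonMangoldt (s := 1 + (a : ℂ)) (by simpa using ha)).norm
  have hS := hasSum_integral_of_summable_integral_norm hInt hsum
  have e1 : ∀ y : ℝ, ∑' n, F n y = VM (1 + ((a : ℂ) + y * I)) * ((X : ℂ) ^ ((a : ℂ) + y * I) * kr (a + y * I)) := by
    intro y
    simp only [hF]
    rw [tsum_mul_right]; rfl
  simp_rw [e1] at hS
  have e2 : ∀ n, ∫ y, F n y = v n / n * (2 * Real.pi * ((max (1 - n / X) 0 : ℝ) : ℂ)) := by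
    intro n
    rcases eq_or_ne n 0 with rfl | hn
    · rw [hF0]; simp
    · rw [hFn n hn]
      have hnp : (0 : ℝ) < n := by exact_mod_cast Nat.pos_of_ne_zero hn
      rw [integral_const_mul, perron1 ha ha2 (div_pos hnp hX)]
  simp_rw [e2] at hS
  have hS2 : HasSum (fun n : ℕ => v n / n * (2 * Real.pi * ((max (1 - n / X) 0 : ℝ) : ℂ)))
      (∑ n ∈ Finset.Icc 1 ⌊X⌋₊, v n / n * (2 * Real.pi * ((max (1 - n / X) 0 : ℝ) : ℂ))) := by
    refine hasSum_sum_of_ne_finset_zero fun n hn => ?_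
    rw [Finset.mem_Icc, not_and_or] at hn
    rcases hn with hn | hn
    · have : n = 0 := by omega
      subst this; simp
    · have : X < n := (Nat.floor_lt hX.le).mp (not_le.mp hn)
      rw [max_eq_right]
      · simp
      · have : 1 ≤ n / X := by rw [le_div_iff₀ hX]; linarith
        linarith
  rw [hS.unique hS2, TT, ofReal_sum, Finset.mul_sum]
  refine Finset.sum_congr rfl fun n hn => ?_
  have : (n : ℝ) ≤ X := (Nat.le_floor_iff hX.le).mp (Finset.mem_Icc.mp hn).2
  rw [max_eq_left]
  · simp only [hv]; push_cast; ring
  · have : n / X ≤ 1 := by rw [div_le_iff₀ hX]; linarith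
    linarith

lemma HH_line_bound : ∃ C : ℝ, 0 < C ∧ ∀ a : ℝ, 0 < a → a ≤ 1 / 2 → ∀ y : ℝ,
    ‖HH (1 + ((a : ℂ) + y * I))‖ ≤ C * lg y ^ 2 := by
  obtain ⟨c, hc0, hc4, B, hB, h⟩ := HH_bound
  refine ⟨B, hB, fun a ha ha2 y => ?_⟩
  have := (h (1 + ((a : ℂ) + y * I)) ?_ ?_).2
  · simpa using this
  · have : 0 ≤ c / lg (1 + ((a : ℂ) + y * I)).im := by
      have := one_le_lg (1 + ((a : ℂ) + y * I)).im
      positivity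
    simp only [add_re, one_re, ofReal_re, mul_re, I_re, I_im, ofReal_im]
    linarith
  · simp; linarith

lemma lg_sq_le (y : ℝ) : lg y ^ 2 ≤ 64 * (1 + |y|) ^ (1 / 2 : ℝ) := by
  have h0 := abs_nonneg y
  have h1 : lg y ≤ (|y| + 3) ^ (1 / 4 : ℝ) / (1 / 4) := Real.log_le_rpow_div (by positivity) (by norm_num)
  have h2 : (|y| + 3) ^ (1 / 4 : ℝ) ≤ 2 * (1 + |y|) ^ (1 / 4 : ℝ) := by
    calc (|y| + 3) ^ (1 / 4 : ℝ) ≤ (16 * (1 + |y|)) ^ (1 / 4 : ℝ) := by gcongr; linarith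
      _ = _ := by
        rw [Real.mul_rpow (by norm_num) (by positivity)]
        congr 1
        rw [show (16 : ℝ) = 2 ^ (4 : ℝ) by norm_num, ← Real.rpow_mul (by norm_num)]
        norm_num
  have h3 : lg y ≤ 8 * (1 + |y|) ^ (1 / 4 : ℝ) := by linarith
  have h4 := one_le_lg y
  calc lg y ^ 2 ≤ (8 * (1 + |y|) ^ (1 / 4 : ℝ)) ^ 2 := by gcongr
    _ = 64 * (1 + |y|) ^ (1 / 2 : ℝ) := by
      rw [mul_pow, ← Real.rpow_natCast ((1 + |y|) ^ (1 / 4 : ℝ)), ← Real.rpow_mul (by positivity)]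
      norm_num

end PNTAux


namespace PNTAux
open Complex Metric Set Filter Topology MeasureTheory

/-- The integrand. -/
noncomputable def hh (X : ℝ) (s : ℂ) : ℂ := HH (1 + s) * ((X : ℂ) ^ s * kr s)

lemma hh_cont {X a : ℝ} (hX : 0 < X) (ha : 0 < a) : Continuous (fun y : ℝ => hh X (a + y * I)) := by
  unfold hh
  refine Continuous.mul ?_ ((cpow_line_cont hX a).mul (kr_cont ha))
  rw [continuous_iff_continuousAt]
  intro y
  have h1 : ContinuousAt HH (1 + ((a : ℂ) + y * I)) :=
    (HH_diff (zeta1_ne_zero (by simp; linarith))).continuousAt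
  exact ContinuousAt.comp (f := fun y : ℝ => 1 + ((a : ℂ) + y * I)) h1 (by fun_prop)

lemma one_add_rpow_int {r : ℝ} (hr : 1 < r) : Integrable (fun y : ℝ => (1 + |y|) ^ (-r)) := by
  have := integrable_one_add_norm (E := ℝ) (μ := volume) (r := r) (by simpa using hr)
  simpa using this

lemma hh_pre_bound {C : ℝ} (hC : 0 < C) (y : ℝ) {h k M : ℝ} (h0 : 0 ≤ k) (h1 : h ≤ C * lg y ^ 2)
    (_hM : 0 ≤ M) (h2 : k ≤ M * ((1 + |y|) ^ 2)⁻¹) : h * k ≤ 64 * C * M * (1 + |y|) ^ (-(3 / 2) : ℝ) := by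
  have hy := lg_sq_le y
  have hp : (0 : ℝ) < 1 + |y| := by positivity
  have e : (1 + |y|) ^ (-(3 / 2) : ℝ) = (1 + |y|) ^ (1 / 2 : ℝ) * ((1 + |y|) ^ 2)⁻¹ := by
    rw [← Real.rpow_natCast, ← Real.rpow_neg hp.le, ← Real.rpow_add hp]; norm_num
  calc h * k ≤ (C * (64 * (1 + |y|) ^ (1 / 2 : ℝ))) * (M * ((1 + |y|) ^ 2)⁻¹) := by
        have : h ≤ C * (64 * (1 + |y|) ^ (1 / 2 : ℝ)) := h1.trans (by gcongr)
        gcongr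
    _ = _ := by rw [e]; ring

lemma norm_hh {X : ℝ} (hX : 0 < X) (a y : ℝ) : ‖hh X (a + y * I)‖ =
    X ^ a * (‖HH (1 + ((a : ℂ) + y * I))‖ * ‖kr (a + y * I)‖) := by
  unfold hh
  rw [norm_mul, norm_mul, norm_cpow_line hX]; ring

lemma hh_int {X a : ℝ} (hX : 0 < X) (ha : 0 < a) (ha2 : a ≤ 1 / 2) :
    Integrable (fun y : ℝ => hh X (a + y * I)) := by
  obtain ⟨C, hC, h⟩ := HH_line_bound
  refine ((one_add_rpow_int (r := 3 / 2) (by norm_num)).const_mul (X ^ a * (64 * C * (8 / a)))).mono'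
    (hh_cont hX ha).aestronglyMeasurable (Eventually.of_forall fun y => ?_)
  rw [norm_hh hX, mul_assoc]
  refine mul_le_mul_of_nonneg_left ?_ (by positivity)
  refine hh_pre_bound hC y (norm_nonneg (kr (a + y * I))) (h a ha ha2 y) (by positivity) ?_
  refine (kr_bound ha.ne' (by rwa [abs_of_pos ha]) y).trans ?_
  rw [abs_of_pos ha]
  have e : 8 / a * ((1 + |y|) ^ 2)⁻¹ = 4 / a * (2 / (1 + |y|) ^ 2) := by ring
  rw [e]
  gcongr
  rw [← one_div, div_le_div_iff₀ (by positivity) (by positivity), ← sq_abs y]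
  nlinarith [sq_nonneg (|y| - 1)]

lemma T_formula {X a : ℝ} (hX : 1 < X) (ha : 0 < a) (ha2 : a ≤ 1 / 2) :
    ∫ y : ℝ, hh X (a + y * I) = 2 * Real.pi * ((TT X - (Real.log X - 1 + 1 / X) +
      Real.eulerMascheroniConstant * (1 - 1 / X) : ℝ) : ℂ) := by
  have hX0 : 0 < X := by linarith
  have hx1 : 1 / X < 1 := by rw [div_lt_one hX0]; exact hX
  have p0 := perron_sum ha ha2 hX0
  have p1 := perron1 ha ha2 (x := 1 / X) (by positivity)
  have p2 := perron2 ha ha2 (x := 1 / X) (by positivity) hx1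
  rw [max_eq_left (by linarith)] at p1
  have ec : ∀ s : ℂ, ((1 / X : ℝ) : ℂ) ^ (-s) = (X : ℂ) ^ s := fun s => by
    rw [cpow_div_neg one_pos hX0]; simp
  simp_rw [ec] at p1 p2
  have i0 := hh_int hX0 ha ha2
  have i1 := cpow_mul_int (a := a) hX0 (kr_int ha ha2)
  have i2 := cpow_mul_int (a := a) hX0 (kr_div_int ha ha2)
  have e : ∀ y : ℝ, VM (1 + ((a : ℂ) + y * I)) * ((X : ℂ) ^ ((a : ℂ) + y * I) * kr (a + y * I)) =
      (hh X (a + y * I) + (X : ℂ) ^ ((a : ℂ) + y * I) * (kr (a + y * I) / (a + y * I))) -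
      Real.eulerMascheroniConstant * ((X : ℂ) ^ ((a : ℂ) + y * I) * kr (a + y * I)) := by
    intro y
    rw [VM_eq (by simpa using ha)]
    unfold hh HH
    rw [add_sub_cancel_left]
    ring
  simp_rw [e] at p0
  rw [integral_sub (i0.fun_add i2) (i1.const_mul _), integral_add i0 i2, integral_const_mul, p1, p2] at p0
  rw [eq_sub_of_add_eq (eq_add_of_sub_eq p0), one_div, Real.log_inv]
  push_cast
  ring

lemma tail_bound : ∃ C : ℝ, 0 < C ∧ ∀ X a T : ℝ, 1 < X → 0 < a → a ≤ 1 / 2 → 1 ≤ T →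
    ‖∫ y in (Ioc (-T) T)ᶜ, hh X (a + y * I)‖ ≤ C * X ^ a * T ^ (-(1 / 4) : ℝ) := by
  obtain ⟨C, hC, h⟩ := HH_line_bound
  set J := ∫ y : ℝ, (1 + |y|) ^ (-(5 / 4) : ℝ) with hJ
  have hJi := one_add_rpow_int (r := 5 / 4) (by norm_num)
  have hJ0 : 0 ≤ J := integral_nonneg fun y => by positivity
  refine ⟨64 * C * 4 * (J + 1), by positivity, fun X a T hX ha ha2 hT => ?_⟩
  have hX0 : 0 < X := by linarith
  have hT0 : 0 < T := by linarith
  have b : ∀ y ∈ (Ioc (-T) T)ᶜ, ‖hh X (a + y * I)‖ ≤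
      (64 * C * 4 * X ^ a * T ^ (-(1 / 4) : ℝ)) * (1 + |y|) ^ (-(5 / 4) : ℝ) := by
    intro y hy
    have hyT : T ≤ |y| := by
      by_contra hlt
      push Not at hlt
      rw [abs_lt] at hlt
      exact hy ⟨hlt.1, hlt.2.le⟩
    have hp : (0 : ℝ) < 1 + |y| := by positivity
    rw [norm_hh hX0]
    have h2 := hh_pre_bound hC y (norm_nonneg (kr (a + y * I))) (h a ha ha2 y) (M := 4) (by norm_num) ?_
    · have e : (1 + |y|) ^ (-(3 / 2) : ℝ) = (1 + |y|) ^ (-(1 / 4) : ℝ) * (1 + |y|) ^ (-(5 / 4) : ℝ) := by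
        rw [← Real.rpow_add hp]; norm_num
      have h3 : (1 + |y|) ^ (-(1 / 4) : ℝ) ≤ T ^ (-(1 / 4) : ℝ) :=
        Real.rpow_le_rpow_of_nonpos hT0 (by linarith) (by norm_num)
      calc _ ≤ X ^ a * (64 * C * 4 * (1 + |y|) ^ (-(3 / 2) : ℝ)) := by gcongr
        _ ≤ X ^ a * (64 * C * 4 * (T ^ (-(1 / 4) : ℝ) * (1 + |y|) ^ (-(5 / 4) : ℝ))) := by
          rw [e]; gcongr
        _ = _ := by ring
    · unfold kr
      rw [norm_div, norm_one, norm_mul, ← div_eq_mul_inv]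
      have q2 : |y| ≤ ‖(a : ℂ) + y * I‖ := by
        have := abs_im_le_norm ((a : ℂ) + y * I); simpa using this
      have q4 : |y| ≤ ‖(a : ℂ) + y * I + 1‖ := by
        have := abs_im_le_norm ((a : ℂ) + y * I + 1); simpa using this
      have hy1 : 1 ≤ |y| := by linarith
      have h5 : |y| * |y| ≤ ‖(a : ℂ) + y * I‖ * ‖(a : ℂ) + y * I + 1‖ := by gcongr
      rw [div_le_div_iff₀ (by nlinarith) (by positivity)]
      nlinarith
  have hms : MeasurableSet (Ioc (-T) T)ᶜ := measurableSet_Ioc.compl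
  have hi : Integrable (fun y : ℝ => (64 * C * 4 * X ^ a * T ^ (-(1 / 4) : ℝ)) * (1 + |y|) ^ (-(5 / 4) : ℝ)) :=
    hJi.const_mul _
  calc ‖∫ y in (Ioc (-T) T)ᶜ, hh X (a + y * I)‖
      ≤ ∫ y in (Ioc (-T) T)ᶜ, (64 * C * 4 * X ^ a * T ^ (-(1 / 4) : ℝ)) * (1 + |y|) ^ (-(5 / 4) : ℝ) :=
        norm_integral_le_of_norm_le hi.integrableOn ((ae_restrict_iff' hms).mpr (Eventually.of_forall b))
    _ ≤ ∫ y, (64 * C * 4 * X ^ a * T ^ (-(1 / 4) : ℝ)) * (1 + |y|) ^ (-(5 / 4) : ℝ) :=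
        setIntegral_le_integral hi (Eventually.of_forall fun y => by positivity)
    _ = (64 * C * 4 * X ^ a * T ^ (-(1 / 4) : ℝ)) * J := by rw [integral_const_mul]
    _ ≤ (64 * C * 4 * X ^ a * T ^ (-(1 / 4) : ℝ)) * (J + 1) := by gcongr; linarith
    _ = _ := by ring

lemma contour {X a δ T M : ℝ} (hX : 1 < X) (ha : 0 < a) (hδ : 0 < δ) (hδ2 : δ ≤ 1 / 2)
    (hT : 1 ≤ T) (hM : 0 ≤ M)
    (hH : ∀ s : ℂ, -δ ≤ s.re → s.re ≤ a → |s.im| ≤ T → riemannZeta₁ (1 + s) ≠ 0 ∧ ‖HH (1 + s)‖ ≤ M) :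
    ‖∫ y in (-T)..T, hh X (a + y * I)‖ ≤
      M * (X ^ (-δ) * (4 / δ * Real.pi)) + 2 * (M * (X ^ a * (1 / T ^ 2)) * (a + δ)) := by
  have hX0 : 0 < X := by linarith
  have hXc : (X : ℂ) ≠ 0 := by exact_mod_cast hX0.ne'
  set f : ℂ → ℂ := fun s => dslope HH 1 (1 + s) * ((X : ℂ) ^ s * (1 / (s + 1))) with hf
  have hfs : ∀ s : ℂ, s ≠ 0 → f s = hh X s := by
    intro s hs
    simp only [hf, hh, kr]
    have h1 : (1 : ℂ) + s ≠ 1 := by simpa using hs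
    rw [dslope_of_ne _ h1, slope_def_field, HH_one, sub_zero, add_sub_cancel_left]
    rw [one_div, one_div, mul_inv]
    ring
  have hU : IsOpen {w : ℂ | riemannZeta₁ w ≠ 0} :=
    isOpen_ne_fun differentiable_riemannZeta₁.continuous continuous_const
  have hds : DifferentiableOn ℂ (dslope HH 1) {w : ℂ | riemannZeta₁ w ≠ 0} := by
    rw [Complex.differentiableOn_dslope (hU.mem_nhds (by simp))]
    exact fun w hw => (HH_diff hw).differentiableWithinAt
  have hle : -δ ≤ a := by linarith
  have hTle : -T ≤ T := by linarith
  have hd : DifferentiableOn ℂ f ((uIcc ((-δ : ℝ) + (-T : ℝ) * I : ℂ).re ((a : ℝ) + (T : ℝ) * I : ℂ).re) ×ℂ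
      (uIcc ((-δ : ℝ) + (-T : ℝ) * I : ℂ).im ((a : ℝ) + (T : ℝ) * I : ℂ).im)) := by
    intro s hs
    rw [mem_reProdIm] at hs
    simp only [add_re, add_im, ofReal_re, ofReal_im, mul_re, mul_im, I_re, I_im, mul_zero, mul_one,
      sub_zero, add_zero, zero_add, zero_mul] at hs
    rw [uIcc_of_le hle, uIcc_of_le hTle] at hs
    have hz := (hH s hs.1.1 hs.1.2 (abs_le.mpr hs.2)).1
    refine DifferentiableAt.differentiableWithinAt ?_
    have hs1 : s + 1 ≠ 0 := ne_zero_of_re (by simp only [add_re, one_re]; linarith [hs.1.1])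
    refine DifferentiableAt.mul ?_ (DifferentiableAt.mul ?_ ?_)
    · exact DifferentiableAt.comp (f := fun s : ℂ => 1 + s) s (hds.differentiableAt (hU.mem_nhds hz)) (by fun_prop)
    · exact DifferentiableAt.const_cpow (by fun_prop) (Or.inl hXc)
    · exact DifferentiableAt.div (by fun_prop) (by fun_prop) hs1
  have hrect := Complex.integral_boundary_rect_eq_zero_of_differentiableOn f _ _ hd
  simp only [add_re, add_im, ofReal_re, ofReal_im, mul_re, mul_im, I_re, I_im, mul_zero, mul_one,
      sub_zero, add_zero, zero_add, zero_mul] at hrect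
  have hT0 : 0 < T := by linarith
  -- horizontal bounds
  have hhor : ∀ t : ℝ, |t| = T → ‖∫ x in (-δ)..a, f (x + t * I)‖ ≤ M * (X ^ a * (1 / T ^ 2)) * (a + δ) := by
    intro t ht
    have := intervalIntegral.norm_integral_le_of_norm_le_const (a := -δ) (b := a)
      (f := fun x : ℝ => f (x + t * I)) (C := M * (X ^ a * (1 / T ^ 2))) ?_
    · rwa [sub_neg_eq_add, abs_of_pos (by linarith)] at this
    · intro x hx
      rw [uIoc_of_le hle] at hx
      have hne : (x : ℂ) + t * I ≠ 0 := by
        intro h0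
        have := congrArg im h0
        simp at this
        rw [this, abs_zero] at ht; linarith
      rw [hfs _ hne, norm_hh hX0]
      have q2 : T ≤ ‖(x : ℂ) + t * I‖ := by
        have := abs_im_le_norm ((x : ℂ) + t * I); simpa [ht] using this
      have q4 : T ≤ ‖(x : ℂ) + t * I + 1‖ := by
        have := abs_im_le_norm ((x : ℂ) + t * I + 1); simpa [ht] using this
      have q5 : ‖kr (x + t * I)‖ ≤ 1 / T ^ 2 := by
        unfold kr
        rw [norm_div, norm_one, norm_mul, sq]
        gcongr
      have q6 := (hH (x + t * I) (by simpa using hx.1.le) (by simpa using hx.2) (by simp [ht])).2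
      have q7 : X ^ x ≤ X ^ a := Real.rpow_le_rpow_of_exponent_le hX.le hx.2
      calc _ ≤ X ^ a * (M * (1 / T ^ 2)) := by gcongr
        _ = _ := by ring
  have hleft : ‖∫ y in (-T)..T, f ((-δ : ℝ) + y * I)‖ ≤ M * (X ^ (-δ) * (4 / δ * Real.pi)) := by
    have hb : ∀ y ∈ Ioc (-T) T, ‖f ((-δ : ℝ) + y * I)‖ ≤ (M * (X ^ (-δ) * (4 / δ))) * (1 + y ^ 2)⁻¹ := by
      intro y hy
      have hne : ((-δ : ℝ) : ℂ) + y * I ≠ 0 := by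
        intro h0
        have := congrArg re h0
        simp at this
        linarith
      rw [hfs _ hne, norm_hh hX0]
      have q1 := kr_bound (a := -δ) (by linarith) (by rwa [abs_neg, abs_of_pos hδ]) y
      rw [abs_neg, abs_of_pos hδ] at q1
      have q6 := (hH ((-δ : ℝ) + y * I) (by simp) (by simp; linarith) (by simpa using abs_le.mpr ⟨hy.1.le, hy.2⟩)).2
      calc _ ≤ X ^ (-δ) * (M * (4 / δ * (1 + y ^ 2)⁻¹)) := by gcongr
        _ = _ := by ring
    have := intervalIntegral.norm_integral_le_of_norm_le hTle (Eventually.of_forall hb)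
      ((integrable_inv_one_add_sq.const_mul _).intervalIntegrable)
    refine this.trans ?_
    rw [intervalIntegral.integral_const_mul, integral_inv_one_add_sq]
    have h1 := Real.arctan_lt_pi_div_two T
    have h2 := Real.neg_pi_div_two_lt_arctan (-T)
    calc _ ≤ (M * (X ^ (-δ) * (4 / δ))) * Real.pi := by gcongr; linarith
      _ = _ := by ring
  have hright : ∫ y in (-T)..T, f (a + y * I) = ∫ y in (-T)..T, hh X (a + y * I) := by
    refine intervalIntegral.integral_congr fun y _ => ?_
    exact hfs _ (ne_zero_of_re (by simpa using ha))
  rw [hright] at hrect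
  set R := ∫ y in (-T)..T, hh X (a + y * I)
  set Lf := ∫ y in (-T)..T, f ((-δ : ℝ) + y * I)
  set H1 := ∫ x in (-δ)..a, f (x + (-T : ℝ) * I)
  set H2 := ∫ x in (-δ)..a, f (x + (T : ℝ) * I)
  have e : R = Lf + I * (H1 - H2) := by
    simp only [smul_eq_mul] at hrect
    linear_combination (-I) * hrect + (R - Lf) * I_mul_I
  rw [e]
  have a1 := hhor (-T) (by rw [abs_neg, abs_of_pos hT0])
  have a2 := hhor T (abs_of_pos hT0)
  calc ‖Lf + I * (H1 - H2)‖ ≤ ‖Lf‖ + ‖I * (H1 - H2)‖ := norm_add_le _ _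
    _ ≤ ‖Lf‖ + (‖H1‖ + ‖H2‖) := by
      rw [norm_mul, norm_I, one_mul]; gcongr; exact norm_sub_le _ _
    _ ≤ _ := by linarith

end PNTAux


namespace PNTAux
open Complex Metric Set Filter Topology MeasureTheory

lemma fin_aux {A B t t' t'' k k' k'' E : ℝ} (h1 : A ≤ t + 2 * t') (h2 : B ≤ t'')
    (h3 : t ≤ k * E) (h4 : t' ≤ k' * E) (h5 : t'' ≤ k'' * E) : A + B ≤ (k + 2 * k' + k'') * E := by
  linarith

set_option maxHeartbeats 2000000 in
lemma TT_asymp : ∃ A : ℝ, 0 < A ∧ A ≤ 1 / 8 ∧ ∃ C : ℝ, 0 ≤ C ∧ ∀ X : ℝ, Real.exp 4 ≤ X →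
    |TT X - (Real.log X - Real.eulerMascheroniConstant - 1)| ≤ C * Real.exp (-A * √(Real.log X)) := by
  obtain ⟨c, hc0, hc4, B, hB, hH⟩ := HH_bound
  obtain ⟨C3, hC3, htail⟩ := tail_bound
  set g := Real.eulerMascheroniConstant with hg
  set K : ℝ := B * (4 / c * Real.pi) * (6 * (2 / c) ^ 3) + 2 * (B * (Real.exp 1 * 8)) + C3 * Real.exp 1 * 2 with hK
  refine ⟨c / 2, by positivity, by linarith, K + (1 + |g|), by positivity, fun X hX => ?_⟩
  have hX0 : 0 < X := (Real.exp_pos 4).trans_le hX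
  have hX1 : 1 < X := lt_of_lt_of_le (by rw [Real.one_lt_exp_iff]; norm_num) hX
  have hlog : 4 ≤ Real.log X := (Real.le_log_iff_exp_le hX0).mpr hX
  set L := √(Real.log X) with hL
  have hLsq : L ^ 2 = Real.log X := Real.sq_sqrt (by linarith)
  have hL0 : 0 ≤ L := Real.sqrt_nonneg _
  have hL2 : 2 ≤ L := by nlinarith
  have hXL : ∀ u : ℝ, X ^ u = Real.exp (u * L ^ 2) := by
    intro u; rw [Real.rpow_def_of_pos hX0, hLsq, mul_comm]
  set a : ℝ := 1 / L ^ 2 with ha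
  have ha0 : 0 < a := by positivity
  have ha4 : a ≤ 1 / 4 := by
    rw [ha]; apply one_div_le_one_div_of_le (by norm_num); nlinarith
  set δ : ℝ := c / L with hδ
  have hδ0 : 0 < δ := by positivity
  have hδ4 : δ ≤ 1 / 4 := by
    rw [hδ, div_le_iff₀ (by positivity)]; linarith
  set T : ℝ := Real.exp L - 3 with hT
  have he6 : 6 ≤ Real.exp L := by
    have h1 : Real.exp 2 ≤ Real.exp L := Real.exp_le_exp.mpr hL2
    have h2 : Real.exp 2 = Real.exp 1 * Real.exp 1 := by rw [← Real.exp_add]; norm_num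
    nlinarith [Real.exp_one_gt_d9]
  have hT2 : Real.exp L / 2 ≤ T := by rw [hT]; linarith
  have hT1 : 1 ≤ T := by linarith
  have hXa : X ^ a = Real.exp 1 := by
    rw [hXL, ha, one_div_mul_cancel (by positivity)]
  have hXδ : X ^ (-δ) = Real.exp (-(c * L)) := by
    rw [hXL, hδ]; congr 1; field_simp
  set E := Real.exp (-(c / 2) * L) with hE
  have hE0 : 0 < E := Real.exp_pos _
  -- contour
  have k1 := contour (M := B * L ^ 2) hX1 ha0 hδ0 (by linarith) hT1 (by positivity) (fun s h1 h2 h3 => by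
    have hl1 := one_le_lg s.im
    have hlL : lg s.im ≤ L := by
      unfold lg
      rw [Real.log_le_iff_le_exp (by positivity)]; linarith
    have := hH (1 + s) ?_ ?_
    · refine ⟨this.1, this.2.trans ?_⟩
      simp only [add_im, one_im, zero_add]
      gcongr
    · simp only [add_im, one_im, zero_add, add_re, one_re]
      have : δ ≤ c / lg s.im := by rw [hδ]; gcongr
      linarith
    · simp only [add_re, one_re]; linarith)
  rw [hXa, hXδ] at k1
  have k2 := htail X a T hX1 ha0 (by linarith) hT1
  rw [hXa] at k2
  have hsplit : ∫ y : ℝ, hh X (a + y * I) = (∫ y in (-T)..T, hh X (a + y * I)) +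
      ∫ y in (Ioc (-T) T)ᶜ, hh X (a + y * I) := by
    rw [intervalIntegral.integral_of_le (by linarith)]
    exact (integral_add_compl measurableSet_Ioc (hh_int hX0 ha0 (by linarith))).symm
  have t1 : B * L ^ 2 * (Real.exp (-(c * L)) * (4 / δ * Real.pi)) ≤ B * (4 / c * Real.pi) * (6 * (2 / c) ^ 3) * E := by
    have h1 : (c / 2 * L) ^ 3 / 6 ≤ Real.exp (c / 2 * L) := by
      have := Real.pow_div_factorial_le_exp (c / 2 * L) (by positivity) 3
      simpa [Nat.factorial] using this
    have h2 : L ^ 3 ≤ 6 * (2 / c) ^ 3 * Real.exp (c / 2 * L) := by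
      have : L ^ 3 = 6 * (2 / c) ^ 3 * ((c / 2 * L) ^ 3 / 6) := by field_simp
      rw [this]; gcongr
    have h3 : Real.exp (c / 2 * L) * Real.exp (-(c * L)) = E := by
      rw [← Real.exp_add, hE]; congr 1; ring
    calc B * L ^ 2 * (Real.exp (-(c * L)) * (4 / δ * Real.pi))
        = B * (4 / c * Real.pi) * (L ^ 3 * Real.exp (-(c * L))) := by rw [hδ]; field_simp
      _ ≤ B * (4 / c * Real.pi) * (6 * (2 / c) ^ 3 * Real.exp (c / 2 * L) * Real.exp (-(c * L))) := by gcongr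
      _ = _ := by rw [mul_assoc (6 * (2 / c) ^ 3), h3]; ring
  have hEL : Real.exp (-L) ≤ E := by
    rw [hE]; apply Real.exp_le_exp.mpr; nlinarith
  have t2 : B * L ^ 2 * (Real.exp 1 * (1 / T ^ 2)) * (a + δ) ≤ B * (Real.exp 1 * 8) * E := by
    have h1 : L ^ 2 / 2 ≤ Real.exp L := by
      have := Real.pow_div_factorial_le_exp L hL0 2
      simpa [Nat.factorial] using this
    have h2 : L ^ 2 * (1 / T ^ 2) ≤ 8 * E := by
      calc L ^ 2 * (1 / T ^ 2) ≤ (2 * Real.exp L) * (1 / (Real.exp L / 2) ^ 2) := by gcongr; linarith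
        _ = 8 * Real.exp (-L) := by rw [Real.exp_neg]; field_simp; norm_num
        _ ≤ _ := by gcongr
    calc B * L ^ 2 * (Real.exp 1 * (1 / T ^ 2)) * (a + δ) = B * Real.exp 1 * (L ^ 2 * (1 / T ^ 2)) * (a + δ) := by ring
      _ ≤ B * Real.exp 1 * (8 * E) * 1 := by gcongr; linarith
      _ = _ := by ring
  have t3 : C3 * Real.exp 1 * T ^ (-(1 / 4) : ℝ) ≤ C3 * Real.exp 1 * 2 * E := by
    have h1 : T ^ (-(1 / 4) : ℝ) ≤ 2 * E := by
      calc T ^ (-(1 / 4) : ℝ) ≤ (Real.exp L / 2) ^ (-(1 / 4) : ℝ) :=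
            Real.rpow_le_rpow_of_nonpos (by positivity) hT2 (by norm_num)
        _ = Real.exp (-(L / 4)) * (2 : ℝ) ^ (1 / 4 : ℝ) := by
            rw [Real.div_rpow (by positivity) (by norm_num), ← Real.exp_mul, Real.rpow_neg (by norm_num),
              div_inv_eq_mul]
            congr 2; ring
        _ ≤ E * (2 : ℝ) ^ (1 : ℝ) := by
            gcongr
            · rw [hE]; apply Real.exp_le_exp.mpr; nlinarith
            · norm_num
            · norm_num
        _ = _ := by rw [Real.rpow_one]; ring
    calc _ ≤ C3 * Real.exp 1 * (2 * E) := by gcongr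
      _ = _ := by ring
  have hI : ‖∫ y : ℝ, hh X (a + y * I)‖ ≤ K * E := by
    rw [hsplit, hK]
    refine (norm_add_le _ _).trans ?_
    exact fin_aux k1 k2 t1 t2 t3
  rw [T_formula hX1 ha0 (by linarith), norm_mul, norm_real, Real.norm_eq_abs] at hI
  have hpi : 1 ≤ ‖(2 : ℂ) * Real.pi‖ := by
    rw [norm_mul, norm_real, Real.norm_eq_abs, abs_of_pos Real.pi_pos]
    simp; linarith [Real.pi_gt_three]
  set W := TT X - (Real.log X - 1 + 1 / X) + g * (1 - 1 / X) with hW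
  have hW2 : |W| ≤ K * E := by
    refine le_trans ?_ hI
    nlinarith [abs_nonneg W]
  have hXinv : 1 / X ≤ E := by
    have : 1 / X = Real.exp (-(L ^ 2)) := by rw [hLsq, Real.exp_neg, Real.exp_log hX0, one_div]
    rw [this, hE]; apply Real.exp_le_exp.mpr; nlinarith
  have e : TT X - (Real.log X - g - 1) = W + (1 + g) * (1 / X) := by rw [hW]; ring
  rw [e]
  calc |W + (1 + g) * (1 / X)| ≤ |W| + |(1 + g) * (1 / X)| := abs_add_le _ _
    _ ≤ K * E + (1 + |g|) * E := by
      gcongr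
      rw [abs_mul, abs_of_pos (by positivity : 0 < 1 / X)]
      gcongr
      exact (abs_add_le _ _).trans (by simp)
    _ = _ := by ring

end PNTAux


namespace PNTAux
open Complex Metric Set Filter Topology MeasureTheory

/-- von Mangoldt on proper prime powers. -/
noncomputable def gP (n : ℕ) : ℝ := if n.Prime then 0 else ArithmeticFunction.vonMangoldt n

lemma gP_nonneg (n : ℕ) : 0 ≤ gP n := by
  unfold gP; split_ifs
  · exact le_rfl
  · exact ArithmeticFunction.vonMangoldt_nonneg

/-- Parametrisation of proper prime powers. -/
def eP (c : Nat.Primes × ℕ) : ℕ := (c.1 : ℕ) ^ (c.2 + 2)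

lemma eP_inj : Function.Injective eP := by
  rintro ⟨⟨p, hp⟩, k⟩ ⟨⟨q, hq⟩, l⟩ h
  simp only [eP] at h
  have hpq : p = q := by
    have : p ∣ q ^ (l + 2) := h ▸ dvd_pow_self p (by omega)
    exact (Nat.prime_dvd_prime_iff_eq hp hq).mp (hp.dvd_of_dvd_pow this)
  subst hpq
  have := Nat.pow_right_injective hp.two_le h
  have : k = l := by omega
  subst this; rfl

lemma gP_eP (c : Nat.Primes × ℕ) : gP (eP c) = Real.log c.1 := by
  unfold gP eP
  rw [if_neg (Nat.Prime.not_prime_pow (by omega)), ArithmeticFunction.vonMangoldt_apply_pow (by omega),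
    ArithmeticFunction.vonMangoldt_apply_prime c.1.2]

lemma mem_range_of_gP {n : ℕ} (h : gP n ≠ 0) : n ∈ Set.range eP := by
  unfold gP at h
  split_ifs at h with hp
  · exact absurd rfl h
  · rw [ArithmeticFunction.vonMangoldt_ne_zero_iff, isPrimePow_nat_iff] at h
    obtain ⟨p, k, hpp, hk, rfl⟩ := h
    have : k ≠ 1 := by rintro rfl; rw [pow_one] at hp; exact hp hpp
    refine ⟨(⟨p, hpp⟩, k - 2), ?_⟩
    simp only [eP]
    congr 1; omega

lemma sum_w : Summable (fun n : ℕ => gP n * (n : ℝ) ^ (-(3 / 4) : ℝ)) := by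
  rw [← eP_inj.summable_iff]
  swap
  · intro n hn
    have : gP n = 0 := by
      by_contra h; exact hn (mem_range_of_gP h)
    rw [this, zero_mul]
  have h1 : Summable (fun p : Nat.Primes => 8 * ((p : ℕ) : ℝ) ^ (-(11 / 8) : ℝ)) := by
    refine Summable.mul_left 8 ?_
    exact ((Real.summable_nat_rpow (p := -(11 / 8))).mpr (by norm_num)).comp_injective
      (i := fun p : Nat.Primes => (p : ℕ)) Subtype.val_injective
  have hr : (2 : ℝ) ^ (-(3 / 4) : ℝ) < 1 := Real.rpow_lt_one_of_one_lt_of_neg (by norm_num) (by norm_num)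
  have h2 : Summable (fun k : ℕ => ((2 : ℝ) ^ (-(3 / 4) : ℝ)) ^ k) :=
    summable_geometric_of_lt_one (by positivity) hr
  have h3 := h1.mul_of_nonneg h2 (fun p => by positivity) (fun k => by positivity)
  refine Summable.of_nonneg_of_le (fun c => ?_) (fun c => ?_) h3
  · exact mul_nonneg (gP_nonneg _) (by positivity)
  · obtain ⟨p, k⟩ := c
    simp only [Function.comp]
    rw [gP_eP]
    have hp2 : (2 : ℝ) ≤ (p : ℕ) := by exact_mod_cast p.2.two_le
    have hp0 : (0 : ℝ) < (p : ℕ) := by linarith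
    have hlog : Real.log (p : ℕ) ≤ ((p : ℕ) : ℝ) ^ (1 / 8 : ℝ) / (1 / 8) := Real.log_le_rpow_div hp0.le (by norm_num)
    have e1 : ((eP (p, k) : ℕ) : ℝ) ^ (-(3 / 4) : ℝ) =
        ((p : ℕ) : ℝ) ^ (-(3 / 2) : ℝ) * (((p : ℕ) : ℝ) ^ (-(3 / 4) : ℝ)) ^ k := by
      simp only [eP]
      rw [Nat.cast_pow, ← Real.rpow_natCast, ← Real.rpow_natCast, ← Real.rpow_mul hp0.le,
        ← Real.rpow_mul hp0.le, ← Real.rpow_add hp0]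
      congr 1; push_cast; ring
    have e2 : ((p : ℕ) : ℝ) ^ (-(11 / 8) : ℝ) = ((p : ℕ) : ℝ) ^ (1 / 8 : ℝ) * ((p : ℕ) : ℝ) ^ (-(3 / 2) : ℝ) := by
      rw [← Real.rpow_add hp0]; norm_num
    have e3 : ((p : ℕ) : ℝ) ^ (-(3 / 4) : ℝ) ≤ (2 : ℝ) ^ (-(3 / 4) : ℝ) :=
      Real.rpow_le_rpow_of_nonpos (by norm_num) hp2 (by norm_num)
    rw [e1, e2]
    calc Real.log (p : ℕ) * (((p : ℕ) : ℝ) ^ (-(3 / 2) : ℝ) * (((p : ℕ) : ℝ) ^ (-(3 / 4) : ℝ)) ^ k)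
        ≤ (((p : ℕ) : ℝ) ^ (1 / 8 : ℝ) / (1 / 8)) * (((p : ℕ) : ℝ) ^ (-(3 / 2) : ℝ) * ((2 : ℝ) ^ (-(3 / 4) : ℝ)) ^ k) := by
          gcongr
      _ = _ := by ring

lemma u_le_w (n : ℕ) : gP n / n ≤ gP n * (n : ℝ) ^ (-(3 / 4) : ℝ) := by
  rcases Nat.eq_zero_or_pos n with rfl | hn
  · simp
  · have h1 : (1 : ℝ) ≤ n := by exact_mod_cast hn
    rw [div_eq_mul_inv, ← Real.rpow_neg_one]
    have := gP_nonneg n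
    gcongr
    norm_num

lemma sum_u : Summable (fun n : ℕ => gP n / n) :=
  Summable.of_nonneg_of_le (fun n => div_nonneg (gP_nonneg n) (by positivity)) u_le_w sum_w

lemma tsum_u : ∑' n : ℕ, gP n / n = ∑' (k : ℕ) (p : Nat.Primes), Real.log p / (p : ℝ) ^ (k + 2) := by
  have hval : ∀ c : Nat.Primes × ℕ, gP (eP c) / (eP c : ℕ) = Real.log c.1 / ((c.1 : ℕ) : ℝ) ^ (c.2 + 2) := by
    intro c
    rw [gP_eP]; simp [eP]
  have h1 : ∑' c, gP (eP c) / (eP c : ℕ) = ∑' n : ℕ, gP n / n := by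
    refine eP_inj.tsum_eq (f := fun n : ℕ => gP n / n) fun n hn => mem_range_of_gP ?_
    intro h
    apply hn; simp [h]
  have h2 : Summable (fun c : Nat.Primes × ℕ => Real.log c.1 / ((c.1 : ℕ) : ℝ) ^ (c.2 + 2)) := by
    have := sum_u.comp_injective eP_inj
    refine this.congr fun c => ?_
    exact (hval c)
  rw [← h1]
  simp_rw [hval]
  rw [h2.tsum_prod]
  exact (Summable.tsum_comm (f := fun (p : Nat.Primes) (k : ℕ) => Real.log p / (p : ℝ) ^ (k + 2)) h2).symm

lemma prime_powers : ∃ C : ℝ, 0 ≤ C ∧ ∀ X : ℝ, 1 < X →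
    |(∑ p ∈ (Finset.Icc 1 ⌊X⌋₊).filter Nat.Prime, Real.log p / (p : ℝ) * (1 - (p : ℝ) / X)) -
      (TT X - ∑' (k : ℕ) (p : Nat.Primes), Real.log p / (p : ℝ) ^ (k + 2))| ≤ C * X ^ (-(1 / 4) : ℝ) := by
  refine ⟨∑' n : ℕ, gP n * (n : ℝ) ^ (-(3 / 4) : ℝ),
    tsum_nonneg fun n => mul_nonneg (gP_nonneg n) (by positivity), fun X hX => ?_⟩
  have hX0 : 0 < X := by linarith
  rw [← tsum_u]
  set v : ℕ → ℝ := fun n => if n ∈ Finset.Icc 1 ⌊X⌋₊ then gP n / n * (1 - n / X) else 0 with hv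
  have hvs : HasSum v (∑ n ∈ Finset.Icc 1 ⌊X⌋₊, v n) :=
    hasSum_sum_of_ne_finset_zero fun n hn => by simp only [hv]; rw [if_neg hn]
  have hTS : TT X - (∑ p ∈ (Finset.Icc 1 ⌊X⌋₊).filter Nat.Prime, Real.log p / (p : ℝ) * (1 - (p : ℝ) / X)) =
      ∑ n ∈ Finset.Icc 1 ⌊X⌋₊, v n := by
    rw [Finset.sum_filter, TT, ← Finset.sum_sub_distrib]
    refine Finset.sum_congr rfl fun n hn => ?_
    simp only [hv]
    rw [if_pos hn]
    unfold gP
    split_ifs with hp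
    · rw [ArithmeticFunction.vonMangoldt_apply_prime hp]; simp
    · simp
  have hd := sum_u.hasSum.sub hvs
  have e : (∑ p ∈ (Finset.Icc 1 ⌊X⌋₊).filter Nat.Prime, Real.log p / (p : ℝ) * (1 - (p : ℝ) / X)) -
      (TT X - ∑' n : ℕ, gP n / n) = ∑' n : ℕ, gP n / n - ∑ n ∈ Finset.Icc 1 ⌊X⌋₊, v n := by
    rw [← hTS]; ring
  rw [e, ← hd.tsum_eq, ← tsum_mul_right, ← Real.norm_eq_abs]
  refine tsum_of_norm_bounded (sum_w.mul_right _).hasSum fun n => ?_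
  have hg := gP_nonneg n
  rw [Real.norm_eq_abs]
  simp only [hv]
  split_ifs with hn
  · have hn1 : (1 : ℝ) ≤ n := by exact_mod_cast (Finset.mem_Icc.mp hn).1
    have hnX : (n : ℝ) ≤ X := (Nat.le_floor_iff hX0.le).mp (Finset.mem_Icc.mp hn).2
    have hn0 : (0 : ℝ) < n := by linarith
    have e1 : gP n / n - gP n / n * (1 - n / X) = gP n * X⁻¹ := by field_simp; ring
    have e2 : X⁻¹ = X ^ (-(3 / 4) : ℝ) * X ^ (-(1 / 4) : ℝ) := by
      rw [← Real.rpow_add hX0, ← Real.rpow_neg_one]; norm_num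
    rw [e1, abs_of_nonneg (by positivity), e2, mul_assoc]
    have : X ^ (-(3 / 4) : ℝ) ≤ (n : ℝ) ^ (-(3 / 4) : ℝ) :=
      Real.rpow_le_rpow_of_nonpos hn0 hnX (by norm_num)
    gcongr
  · rw [Finset.mem_Icc, not_and_or] at hn
    rcases hn with hn | hn
    · have : n = 0 := by omega
      subst this; simp [gP]
    · have hnX : X < n := (Nat.floor_lt hX0.le).mp (not_le.mp hn)
      have hn0 : (0 : ℝ) < n := by linarith
      have e2 : (n : ℝ)⁻¹ = (n : ℝ) ^ (-(3 / 4) : ℝ) * (n : ℝ) ^ (-(1 / 4) : ℝ) := by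
        rw [← Real.rpow_add hn0, ← Real.rpow_neg_one]; norm_num
      rw [sub_zero, abs_of_nonneg (by positivity), div_eq_mul_inv, e2, mul_assoc]
      have : (n : ℝ) ^ (-(1 / 4) : ℝ) ≤ X ^ (-(1 / 4) : ℝ) :=
        Real.rpow_le_rpow_of_nonpos hX0 hnX.le (by norm_num)
      gcongr

end PNTAux

/-- As `X → ∞`,
`∑_{p ≤ X} (log p / p)(1 − p/X) = log X − γ − ∑_{k ≥ 2} ∑_p (log p)/p^k − 1
  + O(exp(−A√(log X)))` for some absolute constant `A > 0`, where `γ` is Euler's constant. -/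
theorem sum_log_primes_one_line_asymptotic :
    ∃ A : ℝ, 0 < A ∧ ∃ C : ℝ, ∃ X₀ : ℝ, ∀ X : ℝ, X₀ ≤ X →
      |(∑ p ∈ (Finset.Icc 1 ⌊X⌋₊).filter Nat.Prime,
          Real.log p / (p : ℝ) * (1 - (p : ℝ) / X)) -
        (Real.log X - Real.eulerMascheroniConstant -
          (∑' (k : ℕ) (p : Nat.Primes), Real.log p / (p : ℝ) ^ (k + 2)) - 1)| ≤
        C * Real.exp (-A * Real.sqrt (Real.log X)) := by
  obtain ⟨A, hA0, hA8, C1, hC1, h1⟩ := PNTAux.TT_asymp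
  obtain ⟨C2, hC2, h2⟩ := PNTAux.prime_powers
  refine ⟨A, hA0, C1 + C2, Real.exp 4, fun X hX => ?_⟩
  have hX0 : 0 < X := (Real.exp_pos 4).trans_le hX
  have hX1 : 1 < X := lt_of_lt_of_le (by rw [Real.one_lt_exp_iff]; norm_num) hX
  have hlog : 4 ≤ Real.log X := (Real.le_log_iff_exp_le hX0).mpr hX
  have a1 := h1 X hX
  have a2 := h2 X hX1
  have a3 : X ^ (-(1 / 4) : ℝ) ≤ Real.exp (-A * Real.sqrt (Real.log X)) := by
    rw [Real.rpow_def_of_pos hX0]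
    apply Real.exp_le_exp.mpr
    have hs := Real.sq_sqrt (show 0 ≤ Real.log X by linarith)
    have hs0 := Real.sqrt_nonneg (Real.log X)
    have hs2 : 2 ≤ Real.sqrt (Real.log X) := by nlinarith
    nlinarith
  have a4 : C2 * X ^ (-(1 / 4) : ℝ) ≤ C2 * Real.exp (-A * Real.sqrt (Real.log X)) := by gcongr
  rw [abs_le] at a1 a2 ⊢
  rw [add_mul]
  constructor <;> linarith [a1.1, a1.2, a2.1, a2.2]
end

section
/- Let T ≥ 2, B > 0, X = B · log T · log log T, and let r be the completely multiplicative function with r(p) = 1 − p/X for primes p ≤ X, r(p) = 0 otherwise. Then ∑_{p ≤ X} log(1/(1 − r(p))) ≤ (B + o(1)) · log T · log log T / log(log T · log log T), and consequently ∏_p |1 − r(p)p^{−it}|^{−2} ≤ T^{2B + o(1)} uniformly in t ∈ ℝ as T → ∞. -/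
open Complex Finset

section Tauberian
open MeasureTheory FourierTransform Filter Topology

lemma exists_kernel : ∃ φ : SchwartzMap ℝ ℂ, φ 0 = 1 ∧ ∀ t : ℝ, 2 < |t| → φ t = 0 := by
  let b : ContDiffBump (0 : ℝ) := ⟨1, 2, by norm_num, by norm_num⟩
  have h1 : HasCompactSupport (fun t : ℝ => ((b t : ℝ) : ℂ)) :=
    b.hasCompactSupport.comp_left (g := fun x : ℝ => (x : ℂ)) (by simp)
  have h2 : ContDiff ℝ (⊤ : ℕ∞) (fun t : ℝ => ((b t : ℝ) : ℂ)) :=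
    Complex.ofRealCLM.contDiff.comp b.contDiff
  refine ⟨h1.toSchwartzMap h2, ?_, ?_⟩
  · have : b 0 = 1 := b.one_of_mem_closedBall (by simp [b])
    simp [this]
  · intro t ht
    have : b t = 0 := b.zero_of_le_dist (by simp [b]; exact ht.le)
    simp [this]

lemma integral_fourier_eq_one (φ : SchwartzMap ℝ ℂ) (h : φ 0 = 1) : ∫ v, 𝓕 φ v = 1 := by
  have h1 : 𝓕⁻ (𝓕 φ) = φ := by simp
  have h2 := congrArg (fun f : SchwartzMap ℝ ℂ => f 0) h1
  simp only [SchwartzMap.fourierInv_coe, h] at h2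
  rw [Real.fourierInv_eq] at h2
  simpa using h2

lemma fourier_flip (f g : ℝ → ℂ) (hf : Integrable f) (hg : Integrable g) :
    ∫ v, 𝓕 f v * g v = ∫ t, f t * 𝓕 g t := by
  simpa using! (VectorFourier.integral_fourierIntegral_smul_eq_flip (L := innerₗ ℝ)
      Real.continuous_fourierChar continuous_inner hf hg)

lemma integrable_damped (h : ℝ → ℂ) (hc : Continuous h) (h0 : ∀ y ≤ 0, h y = 0) (M : ℝ)
    (hM : ∀ y, ‖h y‖ ≤ M) (σ : ℝ) (hσ : 0 < σ) :
    Integrable (fun y : ℝ => h y * cexp (-(σ * y : ℂ))) := by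
  have h1 : IntegrableOn (fun y : ℝ => M * Real.exp (-σ * y)) (Set.Ioi 0) :=
    (exp_neg_integrableOn_Ioi 0 hσ).const_mul M
  rw [← integrable_indicator_iff measurableSet_Ioi] at h1
  refine h1.mono' (by fun_prop) (Eventually.of_forall fun y => ?_)
  by_cases hy : 0 < y
  · simp only [Set.indicator, Set.mem_Ioi, hy, if_true, norm_mul]
    rw [Complex.norm_exp]
    gcongr
    · exact (norm_nonneg _).trans (hM y)
    · exact hM y
    · simp
  · simp [h0 y (not_lt.1 hy), Set.indicator, hy]

lemma fourier_damped (h : ℝ → ℂ) (H : ℂ → ℂ)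
    (hH : ∀ s : ℂ, 0 < s.re → ∫ y : ℝ, h y * cexp (-(s * y)) = H s)
    (l x σ : ℝ) (hl : 0 < l) (hσ : 0 < σ) (t : ℝ) :
    𝓕 (fun v : ℝ => h (x + v / l) * cexp (-(σ * (x + v / l : ℝ) : ℂ))) t =
      l * cexp (2 * Real.pi * t * l * x * I) * H (σ + 2 * Real.pi * l * t * I) := by
  rw [← hH _ (by simp [hσ]), Real.fourier_real_eq_integral_exp_smul]
  have key : ∀ v : ℝ, cexp (↑(-2 * Real.pi * v * t) * I) •
      (h (x + v / l) * cexp (-(σ * (x + v / l : ℝ) : ℂ))) =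
      (fun y : ℝ => cexp (2 * Real.pi * t * l * x * I) *
        (h y * cexp (-((σ + 2 * Real.pi * l * t * I) * y)))) (x + v / l) := by
    intro v
    simp only [smul_eq_mul]
    have hl' : (l : ℂ) ≠ 0 := by exact_mod_cast hl.ne'
    have : cexp (↑(-2 * Real.pi * v * t) * I) * cexp (-(σ * (x + v / l : ℝ) : ℂ)) =
       cexp (2 * Real.pi * t * l * x * I) * cexp (-((σ + 2 * Real.pi * l * t * I) * (x + v / l : ℝ))) := by
      rw [← Complex.exp_add, ← Complex.exp_add]
      congr 1
      push_cast
      field_simp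
      ring
    linear_combination h (x + v / l) * this
  simp_rw [key]
  rw [Measure.integral_comp_div (fun y => (fun y : ℝ => cexp (2 * Real.pi * t * l * x * I) *
        (h y * cexp (-((σ + 2 * Real.pi * l * t * I) * y)))) (x + y)) l, integral_add_left_eq_self
        (fun y : ℝ => cexp (2 * Real.pi * t * l * x * I) *
        (h y * cexp (-((σ + 2 * Real.pi * l * t * I) * y)))) x, integral_const_mul, abs_of_pos hl]
  simp [mul_assoc]

lemma smoothed_eq (φ : SchwartzMap ℝ ℂ) (hφ : ∀ t : ℝ, 2 < |t| → φ t = 0)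
    (h : ℝ → ℂ) (hc : Continuous h) (h0 : ∀ y ≤ 0, h y = 0) (M : ℝ)
    (hM : ∀ y, ‖h y‖ ≤ M) (H : ℂ → ℂ) (hHc : ContinuousOn H {s | 0 ≤ s.re})
    (hH : ∀ s : ℂ, 0 < s.re → ∫ y : ℝ, h y * cexp (-(s * y)) = H s)
    (l x : ℝ) (hl : 0 < l) :
    ∫ v, 𝓕 φ v * h (x + v / l) =
      ∫ t : ℝ, φ t * (l * cexp (2 * Real.pi * t * l * x * I) * H (2 * Real.pi * l * t * I)) := by
  have hM0 : 0 ≤ M := (norm_nonneg _).trans (hM 0)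
  have h1 : ∀ σ : ℝ, 0 < σ → ∫ v, 𝓕 φ v * (h (x + v / l) * cexp (-(σ * (x + v / l : ℝ) : ℂ))) =
      ∫ t : ℝ, φ t * (l * cexp (2 * Real.pi * t * l * x * I) *
        H (σ + 2 * Real.pi * l * t * I)) := by
    intro σ hσ
    simp_rw [← fourier_damped h H hH l x σ hl hσ]
    apply fourier_flip φ _ φ.integrable
    have := ((integrable_damped h hc h0 M hM σ hσ).comp_add_left x).comp_div hl.ne'
    exact this
  have hl1 : Tendsto (fun σ : ℝ =>
      ∫ v, 𝓕 φ v * (h (x + v / l) * cexp (-(σ * (x + v / l : ℝ) : ℂ)))) (𝓝[>] 0)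
      (𝓝 (∫ v, 𝓕 φ v * h (x + v / l))) := by
    apply tendsto_integral_filter_of_dominated_convergence (fun v => ‖𝓕 φ v‖ * M)
    · refine Eventually.of_forall fun σ => ?_
      have : Continuous (fun v => 𝓕 φ v) := (𝓕 φ).continuous
      exact Continuous.aestronglyMeasurable (by fun_prop)
    · filter_upwards [self_mem_nhdsWithin] with σ hσ
      refine Eventually.of_forall fun v => ?_
      rw [norm_mul]
      gcongr
      by_cases hy : 0 < x + v / l
      · rw [norm_mul, Complex.norm_exp]
        calc _ ≤ M * 1 := by
              gcongr
              · exact hM _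
              · rw [Real.exp_le_one_iff]
                have : 0 < σ * (x + v / l) := mul_pos hσ hy
                have e : (-(σ * (x + v / l : ℝ) : ℂ)).re = -(σ * (x + v / l)) := by
                  rw [← Complex.ofReal_mul, ← Complex.ofReal_neg, Complex.ofReal_re]
                rw [e]; linarith
          _ = M := mul_one _
      · simp [h0 _ (not_lt.1 hy), hM0]
    · exact ((𝓕 φ).integrable).norm.mul_const M
    · refine Eventually.of_forall fun v => ?_
      refine Tendsto.mono_left ?_ nhdsWithin_le_nhds
      have : Continuous (fun σ : ℝ => 𝓕 φ v * (h (x + v / l) * cexp (-(σ * (x + v / l : ℝ) : ℂ)))) := by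
        fun_prop
      simpa using this.tendsto 0
  have hl2 : Tendsto (fun σ : ℝ => ∫ t : ℝ, φ t * (l * cexp (2 * Real.pi * t * l * x * I) *
        H (σ + 2 * Real.pi * l * t * I))) (𝓝[>] 0)
      (𝓝 (∫ t : ℝ, φ t * (l * cexp (2 * Real.pi * t * l * x * I) *
        H (2 * Real.pi * l * t * I)))) := by
    have hcomp : ContinuousOn (fun q : ℝ × ℝ => H (q.1 + 2 * Real.pi * l * q.2 * I))
        {q | 0 ≤ q.1} := by
      refine hHc.comp (by fun_prop) ?_
      intro q hq
      simpa using hq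
    obtain ⟨C, hC⟩ := (isCompact_Icc.prod isCompact_Icc :
      IsCompact (Set.Icc (0:ℝ) 1 ×ˢ Set.Icc (-2:ℝ) 2)).exists_bound_of_continuousOn
      (hcomp.mono (fun q hq => hq.1.1))
    apply tendsto_integral_filter_of_dominated_convergence (fun t => ‖φ t‖ * (l * C))
    · filter_upwards [self_mem_nhdsWithin] with σ hσ
      have : Continuous (fun t : ℝ => H (σ + 2 * Real.pi * l * t * I)) := by
        rw [← continuousOn_univ]
        refine hHc.comp (by fun_prop) ?_
        intro q _
        simpa using le_of_lt hσ
      have h5 : Continuous (fun t : ℝ => φ t) := φ.continuous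
      exact (h5.mul (Continuous.mul (by fun_prop) this)).aestronglyMeasurable
    · filter_upwards [Ioo_mem_nhdsGT (show (0:ℝ) < 1 by norm_num)] with σ hσ
      refine Eventually.of_forall fun t => ?_
      by_cases ht : 2 < |t|
      · simp [hφ t ht]
      · have := hC (σ, t) ⟨⟨hσ.1.le, hσ.2.le⟩, abs_le.1 (not_lt.1 ht)⟩
        rw [norm_mul, norm_mul, norm_mul]
        have e : ‖cexp (2 * Real.pi * t * l * x * I)‖ = 1 := by
          have := Complex.norm_exp_ofReal_mul_I (2 * Real.pi * t * l * x)
          push_cast at this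
          exact this
        rw [e, Complex.norm_real, Real.norm_of_nonneg hl.le, mul_one]
        gcongr
    · exact φ.integrable.norm.mul_const _
    · refine Eventually.of_forall fun t => ?_
      have h2 := hcomp (0, t) (by simp)
      have h3 : Tendsto (fun σ : ℝ => (σ, t)) (𝓝[>] 0) (𝓝[{q : ℝ × ℝ | 0 ≤ q.1}] (0, t)) := by
        refine tendsto_nhdsWithin_iff.2 ⟨?_, ?_⟩
        · exact (Continuous.tendsto (by fun_prop : Continuous fun σ : ℝ => (σ, t)) 0).mono_left
            nhdsWithin_le_nhds
        · filter_upwards [self_mem_nhdsWithin] with σ hσ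
          exact le_of_lt hσ
      have h4 := h2.tendsto.comp h3
      simp only [Complex.ofReal_zero, zero_add, Function.comp_def] at h4
      exact (h4.const_mul _).const_mul _
  refine tendsto_nhds_unique hl1 (hl2.congr' ?_)
  filter_upwards [self_mem_nhdsWithin] with σ hσ
  exact (h1 σ hσ).symm

lemma smoothed_tendsto (φ : SchwartzMap ℝ ℂ) (H : ℂ → ℂ) (l : ℝ) (hl : 0 < l) :
    Tendsto (fun x : ℝ => ∫ t : ℝ, φ t *
      (l * cexp (2 * Real.pi * t * l * x * I) * H (2 * Real.pi * l * t * I))) atTop (𝓝 0) := by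
  have h1 := Real.zero_at_infty_fourier (fun t : ℝ => φ t * (l * H (2 * Real.pi * l * t * I)))
  have h2 : Tendsto (fun x : ℝ => -(l * x)) atTop (cocompact ℝ) := by
    have : Tendsto (fun x : ℝ => -(l * x)) atTop atBot :=
      tendsto_neg_atTop_atBot.comp (tendsto_id.const_mul_atTop hl)
    exact this.mono_right atBot_le_cocompact
  refine (h1.comp h2).congr fun x => ?_
  simp only [Function.comp]
  rw [Real.fourier_real_eq_integral_exp_smul]
  congr 1
  ext t
  simp only [smul_eq_mul]
  have : (↑(-2 * Real.pi * t * -(l * x)) * I : ℂ) = 2 * Real.pi * t * l * x * I := by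
    push_cast; ring
  rw [this]; ring

theorem tauberian (h : ℝ → ℂ) (h0 : ∀ y ≤ 0, h y = 0) (M L : ℝ)
    (hL : ∀ x y, ‖h x - h y‖ ≤ L * |x - y|)
    (hM : ∀ y, ‖h y‖ ≤ M) (H : ℂ → ℂ) (hHc : ContinuousOn H {s | 0 ≤ s.re})
    (hH : ∀ s : ℂ, 0 < s.re → ∫ y : ℝ, h y * cexp (-(s * y)) = H s) :
    Tendsto h atTop (𝓝 0) := by
  have hL0 : 0 ≤ L := by
    have := (norm_nonneg _).trans (hL 1 0)
    simpa using this
  have hc : Continuous h := by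
    have : LipschitzWith (Real.toNNReal L) h := by
      apply LipschitzWith.of_dist_le_mul
      intro x y
      rw [dist_eq_norm, Real.dist_eq, Real.coe_toNNReal _ hL0]
      exact hL x y
    exact this.continuous
  obtain ⟨φ, hφ1, hφ2⟩ := exists_kernel
  have hK : Integrable (fun v : ℝ => |v| * ‖𝓕 φ v‖) := by
    have := (𝓕 φ).integrable_pow_mul volume 1
    simp only [pow_one, Real.norm_eq_abs] at this
    exact this
  set A := ∫ v : ℝ, |v| * ‖𝓕 φ v‖ with hA
  have hA0 : 0 ≤ A := integral_nonneg fun v => by positivity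
  have approx : ∀ l : ℝ, 0 < l → ∀ x, ‖h x - ∫ v, 𝓕 φ v * h (x + v / l)‖ ≤ L / l * A := by
    intro l hl x
    have e1 : h x = ∫ v, 𝓕 φ v * h x := by
      rw [integral_mul_const, integral_fourier_eq_one φ hφ1, one_mul]
    have i1 : Integrable (fun v => 𝓕 φ v * h x) := ((𝓕 φ).integrable).mul_const _
    have i2 : Integrable (fun v => 𝓕 φ v * h (x + v / l)) :=
      ((𝓕 φ).integrable).mul_bdd (c := M)
        (Continuous.aestronglyMeasurable (by fun_prop)) (Eventually.of_forall fun v => hM _)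
    have e2 : h x - ∫ v, 𝓕 φ v * h (x + v / l) = ∫ v, 𝓕 φ v * (h x - h (x + v / l)) := by
      conv_lhs => rw [e1]
      rw [← integral_sub i1 i2]
      simp_rw [mul_sub]
    rw [e2, hA, ← integral_const_mul]
    refine norm_integral_le_of_norm_le (hK.const_mul _) (Eventually.of_forall fun v => ?_)
    rw [norm_mul]
    have := hL x (x + v / l)
    have e : |x - (x + v / l)| = |v| / l := by
      rw [sub_add_cancel_left, abs_neg, abs_div, abs_of_pos hl]
    rw [e] at this
    calc _ ≤ ‖𝓕 φ v‖ * (L * (|v| / l)) := by gcongr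
      _ = _ := by ring
  rw [Metric.tendsto_atTop]
  intro ε hε
  obtain ⟨l, hl, hl2⟩ : ∃ l : ℝ, 0 < l ∧ L / l * A < ε / 2 := by
    refine ⟨2 * (L * A + 1) / ε, by positivity, ?_⟩
    rw [div_mul_eq_mul_div, div_lt_iff₀ (by positivity)]
    field_simp
    linarith
  have ht := smoothed_tendsto φ H l hl
  rw [Metric.tendsto_atTop] at ht
  obtain ⟨N, hN⟩ := ht (ε / 2) (by positivity)
  refine ⟨N, fun x hx => ?_⟩
  have h1 := hN x hx
  have h2 := approx l hl x
  rw [smoothed_eq φ hφ2 h hc h0 M hM H hHc hH l x hl] at h2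
  rw [dist_zero_right] at h1 ⊢
  have := norm_sub_norm_le (h x) (∫ t : ℝ, φ t *
      (l * cexp (2 * Real.pi * t * l * x * I) * H (2 * Real.pi * l * t * I)))
  linarith

end Tauberian

section Primes
open MeasureTheory Filter Topology ArithmeticFunction

lemma integrable_ramp_real (c w : ℝ) (hw : 0 < w) :
    IntegrableOn (fun y : ℝ => (y - c) * Real.exp (-(w * y))) (Set.Ioi c) := by
  have hd : ∀ y ∈ Set.Ici c, HasDerivAt
      (fun y : ℝ => -((y - c) / w + 1 / w ^ 2) * Real.exp (-(w * y)))
      ((y - c) * Real.exp (-(w * y))) y := by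
    intro y _
    have h1 : HasDerivAt (fun y : ℝ => -((y - c) / w + 1 / w ^ 2)) (-(1 / w)) y :=
      ((((hasDerivAt_id y).sub_const c).div_const w).add_const _).neg
    have h2 : HasDerivAt (fun y : ℝ => Real.exp (-(w * y))) (Real.exp (-(w * y)) * (-(w * 1))) y :=
      (((hasDerivAt_id y).const_mul w).neg).exp
    refine (h1.mul h2).congr_deriv ?_
    field_simp
    ring
  refine integrableOn_Ioi_deriv_of_nonneg' (l := 0) hd ?_ ?_
  · intro y hy
    have : 0 < y - c := sub_pos.2 hy
    positivity
  · have h1 : Tendsto (fun y : ℝ => y * Real.exp (-(w * y))) atTop (𝓝 0) := by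
      simpa using tendsto_rpow_mul_exp_neg_mul_atTop_nhds_zero 1 w hw
    have h2 : Tendsto (fun y : ℝ => Real.exp (-(w * y))) atTop (𝓝 0) := by
      simpa using tendsto_rpow_mul_exp_neg_mul_atTop_nhds_zero 0 w hw
    have h3 := (h1.const_mul (-1 / w)).add (h2.const_mul (c / w - 1 / w ^ 2))
    simp only [mul_zero, add_zero] at h3
    refine h3.congr fun y => ?_
    ring

lemma integrableOn_ramp (c : ℝ) (w : ℂ) (hw : 0 < w.re) :
    IntegrableOn (fun y : ℝ => ((y - c : ℝ) : ℂ) * cexp (-(w * y))) (Set.Ioi c) := by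
  refine Integrable.mono' (integrable_ramp_real c w.re hw)
    (Continuous.aestronglyMeasurable (by fun_prop)) ?_
  refine (ae_restrict_mem measurableSet_Ioi).mono fun y hy => ?_
  have : 0 < y - c := sub_pos.2 hy
  rw [norm_mul, Complex.norm_real, Real.norm_of_nonneg this.le, Complex.norm_exp]
  simp

lemma integral_ramp_Ioi (c : ℝ) (w : ℂ) (hw : 0 < w.re) :
    ∫ y in Set.Ioi c, ((y - c : ℝ) : ℂ) * cexp (-(w * y)) = cexp (-(w * c)) / w ^ 2 := by
  have hw0 : w ≠ 0 := by rintro rfl; simp at hw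
  have hd : ∀ y ∈ Set.Ici c, HasDerivAt
      (fun y : ℝ => -(((y - c : ℝ) : ℂ) / w + 1 / w ^ 2) * cexp (-(w * y)))
      (((y - c : ℝ) : ℂ) * cexp (-(w * y))) y := by
    intro y _
    have h0 : HasDerivAt (fun y : ℝ => ((y - c : ℝ) : ℂ)) ((1 : ℝ) : ℂ) y :=
      ((hasDerivAt_id y).sub_const c).ofReal_comp
    have h1 : HasDerivAt (fun y : ℝ => -(((y - c : ℝ) : ℂ) / w + 1 / w ^ 2))
      (-(((1 : ℝ) : ℂ) / w)) y := ((h0.div_const w).add_const _).neg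
    have h2 : HasDerivAt (fun y : ℝ => cexp (-(w * y))) (cexp (-(w * y)) * (-(w * ((1 : ℝ) : ℂ)))) y :=
      ((((hasDerivAt_id y).ofReal_comp).const_mul w).neg).cexp
    refine (h1.mul h2).congr_deriv ?_
    push_cast
    field_simp
    ring
  have := integral_Ioi_of_hasDerivAt_of_tendsto' (m := 0) hd (integrableOn_ramp c w hw) ?_
  · rw [this]
    simp
    ring
  · rw [tendsto_zero_iff_norm_tendsto_zero]
    have h1 : Tendsto (fun y : ℝ => y * Real.exp (-(w.re * y))) atTop (𝓝 0) := by
      simpa using tendsto_rpow_mul_exp_neg_mul_atTop_nhds_zero 1 w.re hw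
    have h2 : Tendsto (fun y : ℝ => Real.exp (-(w.re * y))) atTop (𝓝 0) := by
      simpa using tendsto_rpow_mul_exp_neg_mul_atTop_nhds_zero 0 w.re hw
    have h3 := (h1.const_mul (1 / ‖w‖)).add (h2.const_mul (-c / ‖w‖ + 1 / ‖w‖ ^ 2))
    simp only [mul_zero, add_zero] at h3
    refine squeeze_zero' (Eventually.of_forall fun _ => norm_nonneg _) ?_ h3
    filter_upwards [eventually_ge_atTop c] with y hy
    rw [norm_mul, Complex.norm_exp, norm_neg]
    have e : (-(w * y)).re = -(w.re * y) := by simp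
    rw [e]
    have : ‖((y - c : ℝ) : ℂ) / w + 1 / w ^ 2‖ ≤ (y - c) / ‖w‖ + 1 / ‖w‖ ^ 2 := by
      refine (norm_add_le _ _).trans ?_
      rw [norm_div, Complex.norm_real, Real.norm_of_nonneg (sub_nonneg.2 hy)]
      simp
    calc _ ≤ ((y - c) / ‖w‖ + 1 / ‖w‖ ^ 2) * Real.exp (-(w.re * y)) := by gcongr
      _ = _ := by ring

lemma ramp_eq_indicator (c : ℝ) (w : ℂ) :
    (fun y : ℝ => ((max (y - c) 0 : ℝ) : ℂ) * cexp (-(w * y))) =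
      (Set.Ioi c).indicator (fun y : ℝ => ((y - c : ℝ) : ℂ) * cexp (-(w * y))) := by
  ext y
  by_cases hy : c < y
  · rw [Set.indicator_of_mem (Set.mem_Ioi.2 hy), max_eq_left (sub_pos.2 hy).le]
  · rw [Set.indicator_of_notMem (by simpa using hy), max_eq_right (by linarith [not_lt.1 hy])]
    simp

lemma integrable_ramp (c : ℝ) (w : ℂ) (hw : 0 < w.re) :
    Integrable (fun y : ℝ => ((max (y - c) 0 : ℝ) : ℂ) * cexp (-(w * y))) := by
  rw [ramp_eq_indicator, integrable_indicator_iff measurableSet_Ioi]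
  exact integrableOn_ramp c w hw

lemma integral_ramp (c : ℝ) (w : ℂ) (hw : 0 < w.re) :
    ∫ y : ℝ, ((max (y - c) 0 : ℝ) : ℂ) * cexp (-(w * y)) = cexp (-(w * c)) / w ^ 2 := by
  rw [ramp_eq_indicator, integral_indicator measurableSet_Ioi]
  exact integral_ramp_Ioi c w hw

/-- `∑ Λ(n) (y - log n)⁺`. -/
noncomputable def psiOne (y : ℝ) : ℝ := ∑' n : ℕ, Λ n * max (y - Real.log n) 0

lemma psiOne_term_zero {y z : ℝ} (hz : z ≤ y) {n : ℕ} (hn : n ∉ Finset.Icc 0 ⌊Real.exp y⌋₊) :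
    Λ n * max (z - Real.log n) 0 = 0 := by
  have h1 : ⌊Real.exp y⌋₊ < n := by simpa using hn
  have h2 : Real.exp y < n := (Nat.floor_lt (Real.exp_pos y).le).1 h1
  have h3 : y < Real.log n := (Real.lt_log_iff_exp_lt ((Real.exp_pos y).trans h2)).2 h2
  rw [max_eq_right (by linarith), mul_zero]

lemma psiOne_eq {y z : ℝ} (hz : z ≤ y) :
    psiOne z = ∑ n ∈ Finset.Icc 0 ⌊Real.exp y⌋₊, Λ n * max (z - Real.log n) 0 :=
  tsum_eq_sum fun _ hn => psiOne_term_zero hz hn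

lemma psiOne_nonpos {y : ℝ} (hy : y ≤ 0) : psiOne y = 0 := by
  rw [psiOne]
  convert tsum_zero with n
  rcases Nat.eq_zero_or_pos n with rfl | hn
  · simp
  · have : 0 ≤ Real.log n := Real.log_natCast_nonneg n
    rw [max_eq_right (by linarith), mul_zero]

lemma psiOne_nonneg (y : ℝ) : 0 ≤ psiOne y :=
  tsum_nonneg fun _ => mul_nonneg vonMangoldt_nonneg (le_max_right _ _)

lemma psiOne_mono : Monotone psiOne := by
  intro z y h
  rw [psiOne_eq h, psiOne_eq le_rfl]
  refine Finset.sum_le_sum fun n _ => mul_le_mul_of_nonneg_left ?_ vonMangoldt_nonneg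
  gcongr

lemma psiOne_sub_le {y z : ℝ} (h : z ≤ y) :
    psiOne y - psiOne z ≤ (Real.log 4 + 4) * Real.exp y * (y - z) := by
  have h1 : psiOne y - psiOne z ≤ Chebyshev.psi (Real.exp y) * (y - z) := by
    rw [psiOne_eq h, psiOne_eq le_rfl, ← Finset.sum_sub_distrib, Chebyshev.psi_eq_sum_Icc,
      Finset.sum_mul]
    refine Finset.sum_le_sum fun n _ => ?_
    rw [← mul_sub]
    refine mul_le_mul_of_nonneg_left ?_ vonMangoldt_nonneg
    rcases max_cases (y - Real.log n) 0 with h2 | h2 <;>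
    rcases max_cases (z - Real.log n) 0 with h3 | h3 <;> linarith
  refine h1.trans (mul_le_mul_of_nonneg_right ?_ (sub_nonneg.2 h))
  exact Chebyshev.psi_le_const_mul_self (Real.exp_pos y).le

lemma psiOne_le (y : ℝ) : psiOne y ≤ 2 * (Real.log 4 + 4) * Real.exp y := by
  have hC : 0 < Real.log 4 + 4 := by have := Real.log_pos (show (1:ℝ) < 4 by norm_num); linarith
  have key : ∀ N : ℕ, ∀ y : ℝ, y ≤ N → psiOne y ≤ 2 * (Real.log 4 + 4) * Real.exp y := by
    intro N
    induction N with
    | zero =>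
      intro y hy
      rw [psiOne_nonpos (by simpa using hy)]
      positivity
    | succ N ih =>
      intro y hy
      have h1 := ih (y - 1) (by push_cast at hy; linarith)
      have h2 := psiOne_sub_le (show y - 1 ≤ y by linarith)
      have h3 : 2 * Real.exp (y - 1) ≤ Real.exp y := by
        have : Real.exp y = Real.exp (y - 1) * Real.exp 1 := by rw [← Real.exp_add]; ring_nf
        rw [this]
        have := Real.add_one_le_exp (1 : ℝ)
        nlinarith [Real.exp_pos (y - 1)]
      have h4 := mul_le_mul_of_nonneg_left h3 hC.le
      linarith
  obtain ⟨N, hN⟩ := exists_nat_ge y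
  exact key N y hN

lemma integral_psiOne (w : ℂ) (hw : 1 < w.re) :
    Integrable (fun y : ℝ => (psiOne y : ℂ) * cexp (-(w * y))) ∧
    ∫ y : ℝ, (psiOne y : ℂ) * cexp (-(w * y)) = LSeries (fun n => (Λ n : ℂ)) w / w ^ 2 := by
  have hw0 : 0 < w.re := by linarith
  let G : ℕ → ℝ → ℂ := fun n y =>
    (Λ n : ℂ) * (((max (y - Real.log n) 0 : ℝ) : ℂ) * cexp (-(w * y)))
  have hG1 : ∀ n, Integrable (G n) := fun n => (integrable_ramp _ w hw0).const_mul _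
  have term : ∀ (s : ℂ) (n : ℕ), LSeries.term (fun n => (Λ n : ℂ)) s n =
      (Λ n : ℂ) * cexp (-(s * (Real.log n : ℝ))) := by
    intro s n
    rcases Nat.eq_zero_or_pos n with rfl | hn
    · simp
    · rw [LSeries.term_of_ne_zero hn.ne', Complex.cpow_def_of_ne_zero (by exact_mod_cast hn.ne'),
        Complex.exp_neg, div_eq_mul_inv, Complex.natCast_log, mul_comm s]
  have hGint : ∀ n, ∫ y, G n y = LSeries.term (fun n => (Λ n : ℂ)) w n / w ^ 2 := by
    intro n
    rw [term, integral_const_mul, integral_ramp _ w hw0]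
    ring
  have hGn : ∀ n, ((∫ y, ‖G n y‖ : ℝ) : ℂ) =
      LSeries.term (fun n => (Λ n : ℂ)) (w.re : ℂ) n / (w.re : ℂ) ^ 2 := by
    intro n
    rw [term, ← integral_complex_ofReal, mul_div_assoc, ← integral_ramp _ (w.re : ℂ) (by simpa using hw0),
      ← integral_const_mul]
    congr 1
    ext y
    simp only [G, norm_mul, Complex.norm_real, Complex.norm_exp]
    rw [Real.norm_of_nonneg vonMangoldt_nonneg, Real.norm_of_nonneg (le_max_right _ _)]
    push_cast
    simp
  have hsum : Summable fun n => ∫ y, ‖G n y‖ := by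
    rw [← Complex.summable_ofReal]
    simp_rw [hGn]
    exact (LSeriesSummable_vonMangoldt (s := (w.re : ℂ)) (by simpa using hw)).div_const _
  have hs := hasSum_integral_of_summable_integral_norm hG1 hsum
  have e : (fun y : ℝ => ∑' n, G n y) = (fun y : ℝ => (psiOne y : ℂ) * cexp (-(w * y))) := by
    ext y
    simp only [G, ← mul_assoc]
    rw [tsum_mul_right, psiOne, Complex.ofReal_tsum]
    simp
  rw [e] at hs
  refine ⟨?_, ?_⟩
  · have h1 : IntegrableOn (fun y : ℝ => 2 * (Real.log 4 + 4) * Real.exp (-(w.re - 1) * y))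
        (Set.Ioi 0) := (exp_neg_integrableOn_Ioi 0 (by linarith)).const_mul _
    rw [← integrable_indicator_iff measurableSet_Ioi] at h1
    refine h1.mono' ?_ (Eventually.of_forall fun y => ?_)
    · refine AEStronglyMeasurable.mul ?_ (Continuous.aestronglyMeasurable (by fun_prop))
      exact (Complex.measurable_ofReal.comp psiOne_mono.measurable).aestronglyMeasurable
    · by_cases hy : 0 < y
      · rw [Set.indicator_of_mem (Set.mem_Ioi.2 hy), norm_mul, Complex.norm_real,
          Real.norm_of_nonneg (psiOne_nonneg y), Complex.norm_exp]
        have e1 : (-(w * y)).re = -(w.re * y) := by simp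
        have e2 : Real.exp (-(w.re - 1) * y) = Real.exp y * Real.exp (-(w.re * y)) := by
          rw [← Real.exp_add]; ring_nf
        rw [e1, e2, ← mul_assoc]
        exact mul_le_mul_of_nonneg_right (psiOne_le y) (Real.exp_pos _).le
      · rw [Set.indicator_of_notMem (by simpa using hy), psiOne_nonpos (not_lt.1 hy)]
        simp
  · rw [← hs.tsum_eq, LSeries, ← tsum_div_const]
    simp_rw [hGint]

lemma cmp_eq_indicator (s : ℂ) :
    (fun y : ℝ => ((max (1 - Real.exp (-y)) 0 : ℝ) : ℂ) * cexp (-(s * y))) =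
      (Set.Ioi (0 : ℝ)).indicator (fun y : ℝ => cexp (-s * y) - cexp (-(s + 1) * y)) := by
  ext y
  by_cases hy : 0 < y
  · rw [Set.indicator_of_mem (Set.mem_Ioi.2 hy), max_eq_left (by simp [hy.le])]
    have : -(s + 1) * (y : ℂ) = -(s * y) + -y := by ring
    rw [this, Complex.exp_add]
    push_cast
    ring_nf
  · rw [Set.indicator_of_notMem (by simpa using hy), max_eq_right (by simpa using hy)]
    simp

lemma integral_cmp (s : ℂ) (hs : 0 < s.re) :
    Integrable (fun y : ℝ => ((max (1 - Real.exp (-y)) 0 : ℝ) : ℂ) * cexp (-(s * y))) ∧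
    ∫ y : ℝ, ((max (1 - Real.exp (-y)) 0 : ℝ) : ℂ) * cexp (-(s * y)) = 1 / s - 1 / (s + 1) := by
  have i1 : IntegrableOn (fun y : ℝ => cexp (-s * y)) (Set.Ioi 0) :=
    integrableOn_exp_mul_complex_Ioi (by simpa using hs) 0
  have i2 : IntegrableOn (fun y : ℝ => cexp (-(s + 1) * y)) (Set.Ioi 0) :=
    integrableOn_exp_mul_complex_Ioi (by simp; linarith) 0
  rw [cmp_eq_indicator, integrable_indicator_iff measurableSet_Ioi,
    integral_indicator measurableSet_Ioi]
  refine ⟨i1.sub i2, ?_⟩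
  rw [integral_sub i1 i2, integral_exp_mul_complex_Ioi (by simpa using hs),
    integral_exp_mul_complex_Ioi (by simp; linarith)]
  simp only [Complex.ofReal_zero, mul_zero, Complex.exp_zero]
  rw [neg_div_neg_eq, neg_div_neg_eq]

lemma exists_zeta_aux : ∃ Z : ℂ → ℂ, ContinuousOn Z {s | 1 ≤ s.re} ∧
    ∀ s : ℂ, 1 < s.re → LSeries (fun n => (Λ n : ℂ)) s = Z s + 1 / (s - 1) := by
  refine ⟨vonMangoldt.LFunctionResidueClassAux (1 : ZMod 1),
    vonMangoldt.continuousOn_LFunctionResidueClassAux 1, fun s hs => ?_⟩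
  rw [vonMangoldt.eqOn_LFunctionResidueClassAux isUnit_one hs]
  have : vonMangoldt.residueClass (1 : ZMod 1) = fun n => Λ n := by
    ext n
    simp only [vonMangoldt.residueClass]
    rw [Set.indicator_of_mem]
    exact Subsingleton.elim _ _
  simp [this]

theorem psiOne_tendsto : Tendsto (fun y => psiOne y * Real.exp (-y)) atTop (𝓝 1) := by
  obtain ⟨Z, hZc, hZ⟩ := exists_zeta_aux
  set C := Real.log 4 + 4 with hCdef
  have hC : 0 < C := by have := Real.log_pos (show (1:ℝ) < 4 by norm_num); linarith
  let g : ℝ → ℝ := fun y => psiOne y * Real.exp (-y) - max (1 - Real.exp (-y)) 0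
  have ee : ∀ y : ℝ, Real.exp y * Real.exp (-y) = 1 := fun y => by rw [← Real.exp_add]; simp
  have hb : ∀ y, psiOne y * Real.exp (-y) ≤ 2 * C := by
    intro y
    have := mul_le_mul_of_nonneg_right (psiOne_le y) (Real.exp_pos (-y)).le
    rwa [mul_assoc, ee, mul_one] at this
  have hb0 : ∀ y, 0 ≤ psiOne y * Real.exp (-y) :=
    fun y => mul_nonneg (psiOne_nonneg y) (Real.exp_pos _).le
  have hm : ∀ y : ℝ, max (1 - Real.exp (-y)) 0 ≤ 1 := fun y =>
    max_le (by linarith [Real.exp_pos (-y)]) zero_le_one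
  have hm0 : ∀ y : ℝ, 0 ≤ max (1 - Real.exp (-y)) 0 := fun y => le_max_right _ _
  have lip : ∀ z y : ℝ, z ≤ y → |g y - g z| ≤ (3 * C + 1) * (y - z) := by
    intro z y hzy
    have hd : 0 ≤ y - z := sub_nonneg.2 hzy
    have hexp : Real.exp (-z) - Real.exp (-y) ≤ Real.exp (-z) * (y - z) := by
      have : Real.exp (-y) = Real.exp (-z) * Real.exp (z - y) := by rw [← Real.exp_add]; ring_nf
      rw [this]
      have := Real.add_one_le_exp (z - y)
      nlinarith [Real.exp_pos (-z)]
    have hexp0 : Real.exp (-y) ≤ Real.exp (-z) := Real.exp_le_exp.2 (by linarith)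
    have a1 : |psiOne y * Real.exp (-y) - psiOne z * Real.exp (-z)| ≤ 3 * C * (y - z) := by
      have e : psiOne y * Real.exp (-y) - psiOne z * Real.exp (-z) =
        (psiOne y - psiOne z) * Real.exp (-y) - psiOne z * (Real.exp (-z) - Real.exp (-y)) := by ring
      have u1 : (psiOne y - psiOne z) * Real.exp (-y) ≤ C * (y - z) := by
        have := mul_le_mul_of_nonneg_right (psiOne_sub_le hzy) (Real.exp_pos (-y)).le
        calc _ ≤ _ := this
          _ = C * (y - z) * (Real.exp y * Real.exp (-y)) := by rw [hCdef]; ring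
          _ = _ := by rw [ee, mul_one]
      have u0 : 0 ≤ (psiOne y - psiOne z) * Real.exp (-y) :=
        mul_nonneg (sub_nonneg.2 (psiOne_mono hzy)) (Real.exp_pos _).le
      have v1 : psiOne z * (Real.exp (-z) - Real.exp (-y)) ≤ 2 * C * (y - z) := by
        calc _ ≤ psiOne z * (Real.exp (-z) * (y - z)) :=
              mul_le_mul_of_nonneg_left hexp (psiOne_nonneg z)
          _ = psiOne z * Real.exp (-z) * (y - z) := by ring
          _ ≤ _ := mul_le_mul_of_nonneg_right (hb z) hd
      have v0 : 0 ≤ psiOne z * (Real.exp (-z) - Real.exp (-y)) :=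
        mul_nonneg (psiOne_nonneg z) (by linarith)
      rw [e, abs_le]
      constructor <;> nlinarith
    have a2 : |max (1 - Real.exp (-y)) 0 - max (1 - Real.exp (-z)) 0| ≤ y - z := by
      have c1 : max (1 - Real.exp (-z)) 0 ≤ max (1 - Real.exp (-y)) 0 := by gcongr
      rw [abs_of_nonneg (by linarith)]
      by_cases hz : 0 ≤ z
      · have : Real.exp (-z) ≤ 1 := by simpa using hz
        rw [max_eq_left (by linarith), max_eq_left (by linarith)]
        nlinarith
      · rw [max_eq_right (a := 1 - Real.exp (-z)) (by simpa using (not_le.1 hz).le)]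
        have := Real.add_one_le_exp (-y)
        rw [sub_zero]
        exact max_le (by linarith) hd
    have e : g y - g z = (psiOne y * Real.exp (-y) - psiOne z * Real.exp (-z)) -
      (max (1 - Real.exp (-y)) 0 - max (1 - Real.exp (-z)) 0) := by simp only [g]; ring
    rw [e]
    refine (abs_sub _ _).trans ?_
    linarith
  have main : Tendsto (fun y => (g y : ℂ)) atTop (𝓝 0) := by
    refine tauberian _ ?_ (2 * C + 1) (3 * C + 1) ?_ ?_
      (fun s => (Z (1 + s) - 1) / (1 + s) ^ 2) ?_ ?_
    · intro y hy
      have : max (1 - Real.exp (-y)) 0 = 0 := max_eq_right (by simpa using hy)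
      simp [g, psiOne_nonpos hy, this]
    · intro x y
      rw [← Complex.ofReal_sub, Complex.norm_real, Real.norm_eq_abs]
      rcases le_total x y with h | h
      · rw [abs_sub_comm, abs_sub_comm x y, abs_of_nonneg (sub_nonneg.2 h)]
        exact lip x y h
      · rw [abs_of_nonneg (sub_nonneg.2 h)]
        exact lip y x h
    · intro y
      rw [Complex.norm_real, Real.norm_eq_abs, abs_le]
      have := hb y; have := hb0 y; have := hm y; have := hm0 y
      constructor <;> simp only [g] <;> linarith
    · refine ContinuousOn.div (ContinuousOn.sub (hZc.comp (by fun_prop) ?_) continuousOn_const)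
        (by fun_prop) ?_
      · intro s hs
        simpa using hs
      · intro s hs h
        have h1 : 1 + s = 0 := by simpa using h
        have h2 := congrArg Complex.re h1
        have h3 : 0 ≤ s.re := hs
        simp at h2
        linarith
    · intro s hs
      obtain ⟨i1, e1⟩ := integral_psiOne (1 + s) (by simpa using hs)
      obtain ⟨i2, e2⟩ := integral_cmp s hs
      have e : ∀ y : ℝ, (g y : ℂ) * cexp (-(s * y)) = (psiOne y : ℂ) * cexp (-((1 + s) * y)) -
          ((max (1 - Real.exp (-y)) 0 : ℝ) : ℂ) * cexp (-(s * y)) := by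
        intro y
        have : -((1 + s) * (y : ℂ)) = -y + -(s * y) := by ring
        rw [this, Complex.exp_add]
        simp only [g]
        rw [Complex.ofReal_sub, Complex.ofReal_mul]
        simp only [Complex.ofReal_exp, Complex.ofReal_neg]
        ring
      simp_rw [e]
      rw [integral_sub i1 i2, e1, e2, hZ _ (by simpa using hs)]
      have hs0 : s ≠ 0 := by rintro rfl; simp at hs
      have hs1 : 1 + s ≠ 0 := by
        intro h1
        have h2 := congrArg Complex.re h1
        simp at h2
        linarith
      have hs2 : s + 1 ≠ 0 := by rwa [add_comm]
      rw [add_sub_cancel_left, add_comm s 1]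
      field_simp
      ring
  have main2 : Tendsto g atTop (𝓝 0) := by
    have := (Complex.continuous_re.tendsto 0).comp main
    simpa [Function.comp_def] using this
  have h3 : Tendsto (fun y : ℝ => max (1 - Real.exp (-y)) 0) atTop (𝓝 1) := by
    have : Tendsto (fun y : ℝ => max (1 - Real.exp (-y)) 0) atTop (𝓝 (max (1 - 0) 0)) :=
      (tendsto_const_nhds.sub Real.tendsto_exp_neg_atTop_nhds_zero).max tendsto_const_nhds
    simpa using this
  have := main2.add h3
  simpa [g] using this

lemma sum_log_mul_log_le (X : ℝ) (hX : 0 < X) :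
    ∑ p ∈ (Finset.Icc 1 ⌊X⌋₊).filter Nat.Prime, Real.log (X / p) * Real.log p ≤
      psiOne (Real.log X) := by
  rw [psiOne_eq le_rfl, Real.exp_log hX]
  have : ∀ p ∈ (Finset.Icc 1 ⌊X⌋₊).filter Nat.Prime, Real.log (X / p) * Real.log p =
      Λ p * max (Real.log X - Real.log p) 0 := by
    intro p hp
    simp only [Finset.mem_filter, Finset.mem_Icc] at hp
    have hp0 : (0 : ℝ) < p := by exact_mod_cast hp.2.pos
    have hpX : (p : ℝ) ≤ X := (Nat.le_floor_iff hX.le).1 hp.1.2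
    rw [vonMangoldt_apply_prime hp.2, Real.log_div hX.ne' hp0.ne',
      max_eq_left (sub_nonneg.2 (Real.log_le_log hp0 hpX)), mul_comm]
  rw [Finset.sum_congr rfl this]
  refine Finset.sum_le_sum_of_subset_of_nonneg ?_ ?_
  · intro p hp
    simp only [Finset.mem_filter, Finset.mem_Icc] at hp ⊢
    exact ⟨Nat.zero_le _, hp.1.2⟩
  · intro n _ _
    exact mul_nonneg vonMangoldt_nonneg (le_max_right _ _)

lemma sum_log_eventually (δ : ℝ) (hδ : 0 < δ) : ∀ᶠ X : ℝ in atTop,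
    ∑ p ∈ (Finset.Icc 1 ⌊X⌋₊).filter Nat.Prime, Real.log (X / p) ≤ (1 + δ) * X / Real.log X := by
  obtain ⟨η, hη0, hη1, hη2⟩ : ∃ η : ℝ, 0 < η ∧ η ≤ 1 / 2 ∧ 5 * η ≤ δ := by
    refine ⟨min (1 / 2) (δ / 5), by positivity, min_le_left _ _, ?_⟩
    have := min_le_right (1 / 2) (δ / 5)
    linarith
  have h1 : ∀ᶠ X : ℝ in atTop, psiOne (Real.log X) * Real.exp (-Real.log X) < 1 + η :=
    Real.tendsto_log_atTop.eventually
      (psiOne_tendsto.eventually (gt_mem_nhds (by linarith : (1 : ℝ) < 1 + η)))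
  have h2 : ∀ᶠ X : ℝ in atTop, ‖Real.log X ^ (2 : ℝ)‖ ≤ η * ‖X ^ η‖ :=
    (isLittleO_log_rpow_rpow_atTop 2 hη0).def hη0
  filter_upwards [h1, h2, eventually_gt_atTop (Real.exp 1)] with X h1 h2 hX
  have hX0 : 0 < X := (Real.exp_pos 1).trans hX
  have hlog : 1 < Real.log X := (Real.lt_log_iff_exp_lt hX0).2 hX
  have hX1 : 1 < X := by
    have := Real.add_one_le_exp (1 : ℝ)
    linarith
  have h1' : psiOne (Real.log X) ≤ (1 + η) * X := by
    rw [Real.exp_neg, Real.exp_log hX0, ← div_eq_mul_inv, div_lt_iff₀ hX0] at h1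
    exact h1.le
  set Y := X ^ (1 - η) with hY
  have hYpos : 0 < Y := Real.rpow_pos_of_pos hX0 _
  have h2' : Y * Real.log X ≤ η * X / Real.log X := by
    rw [Real.rpow_two, Real.norm_of_nonneg (by positivity), Real.norm_of_nonneg (by positivity)] at h2
    rw [le_div_iff₀ (by linarith)]
    have e : Y * X ^ η = X := by
      rw [hY, ← Real.rpow_add hX0]; simp
    calc Y * Real.log X * Real.log X = Y * Real.log X ^ 2 := by ring
      _ ≤ Y * (η * X ^ η) := by gcongr
      _ = η * (Y * X ^ η) := by ring
      _ = _ := by rw [e]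
  have hd : 0 < (1 - η) * Real.log X := mul_pos (by linarith) (by linarith)
  have term : ∀ p ∈ (Finset.Icc 1 ⌊X⌋₊).filter Nat.Prime, Real.log (X / p) ≤
      Real.log (X / p) * Real.log p / ((1 - η) * Real.log X) +
        (if (p : ℝ) ≤ Y then Real.log X else 0) := by
    intro p hp
    simp only [Finset.mem_filter, Finset.mem_Icc] at hp
    have hp0 : (0 : ℝ) < p := by exact_mod_cast hp.2.pos
    have hp1 : (1 : ℝ) ≤ p := by exact_mod_cast hp.2.one_le
    have hpX : (p : ℝ) ≤ X := (Nat.le_floor_iff hX0.le).1 hp.1.2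
    have hlp : 0 ≤ Real.log p := Real.log_nonneg hp1
    have hn : 0 ≤ Real.log (X / p) := Real.log_nonneg ((one_le_div hp0).2 hpX)
    split_ifs with h
    · have : Real.log (X / p) ≤ Real.log X := by
        rw [Real.log_div hX0.ne' hp0.ne']; linarith
      have : 0 ≤ Real.log (X / p) * Real.log p / ((1 - η) * Real.log X) := by positivity
      linarith
    · rw [add_zero, le_div_iff₀ hd]
      refine mul_le_mul_of_nonneg_left ?_ hn
      rw [← Real.log_rpow hX0]
      exact Real.log_le_log hYpos (not_le.1 h).le
  refine (Finset.sum_le_sum term).trans ?_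
  rw [Finset.sum_add_distrib, ← Finset.sum_div, ← Finset.sum_filter, Finset.sum_const, nsmul_eq_mul]
  have hcard : ((((Finset.Icc 1 ⌊X⌋₊).filter Nat.Prime).filter (fun p : ℕ => (p : ℝ) ≤ Y)).card : ℝ)
      ≤ Y := by
    have : (((Finset.Icc 1 ⌊X⌋₊).filter Nat.Prime).filter (fun p : ℕ => (p : ℝ) ≤ Y)).card
        ≤ (Finset.Icc 1 ⌊Y⌋₊).card := by
      refine Finset.card_le_card fun p hp => ?_
      simp only [Finset.mem_filter, Finset.mem_Icc] at hp ⊢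
      exact ⟨hp.1.1.1, Nat.le_floor hp.2⟩
    rw [Nat.card_Icc, Nat.add_sub_cancel] at this
    exact (Nat.cast_le.2 this).trans (Nat.floor_le hYpos.le)
  have s1 : (∑ p ∈ (Finset.Icc 1 ⌊X⌋₊).filter Nat.Prime, Real.log (X / p) * Real.log p) /
      ((1 - η) * Real.log X) ≤ (1 + 4 * η) * (X / Real.log X) := by
    rw [div_le_iff₀ hd]
    refine (sum_log_mul_log_le X hX0).trans (h1'.trans ?_)
    have e : (1 + 4 * η) * (X / Real.log X) * ((1 - η) * Real.log X) =
        ((1 + 4 * η) * (1 - η)) * X := by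
      field_simp
    rw [e]
    refine mul_le_mul_of_nonneg_right ?_ hX0.le
    nlinarith
  have s2 : ((((Finset.Icc 1 ⌊X⌋₊).filter Nat.Prime).filter (fun p : ℕ => (p : ℝ) ≤ Y)).card : ℝ) *
      Real.log X ≤ η * X / Real.log X :=
    (mul_le_mul_of_nonneg_right hcard (by linarith)).trans h2'
  have s3 : (1 + 5 * η) * (X / Real.log X) ≤ (1 + δ) * (X / Real.log X) := by
    have : 0 < X / Real.log X := div_pos hX0 (by linarith)
    gcongr
  have e1 : η * X / Real.log X = η * (X / Real.log X) := by ring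
  have e2 : (1 + δ) * X / Real.log X = (1 + δ) * (X / Real.log X) := by ring
  rw [e2]
  rw [e1] at s2
  linarith

lemma prod_bound (X : ℝ) (hX : 0 < X) (r : ℕ → ℝ)
    (hr : ∀ p : ℕ, p.Prime → (p : ℝ) ≤ X → r p = 1 - p / X) (t : ℝ) :
    ∏ p ∈ (Finset.Icc 1 ⌊X⌋₊).filter Nat.Prime,
      (‖(1 - (r p : ℂ) * (p : ℂ) ^ (-(Complex.I * t)))⁻¹‖ ^ 2) ≤
    Real.exp (2 * ∑ p ∈ (Finset.Icc 1 ⌊X⌋₊).filter Nat.Prime, Real.log (1 / (1 - r p))) := by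
  rw [Finset.mul_sum, Real.exp_sum]
  refine Finset.prod_le_prod (fun _ _ => by positivity) fun p hp => ?_
  simp only [Finset.mem_filter, Finset.mem_Icc] at hp
  have hp0 : (0 : ℝ) < p := by exact_mod_cast hp.2.pos
  have hpX : (p : ℝ) ≤ X := (Nat.le_floor_iff hX.le).1 hp.1.2
  have hrp := hr p hp.2 hpX
  have hq : 0 < p / X := div_pos hp0 hX
  have hq1 : p / X ≤ 1 := (div_le_one hX).2 hpX
  have h1r : 1 - r p = p / X := by rw [hrp]; ring
  have hn : ‖(p : ℂ) ^ (-(Complex.I * t))‖ = 1 := by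
    rw [Complex.norm_natCast_cpow_of_pos hp.2.pos]
    simp
  have hlow : p / X ≤ ‖1 - (r p : ℂ) * (p : ℂ) ^ (-(Complex.I * t))‖ := by
    have := norm_sub_norm_le (1 : ℂ) ((r p : ℂ) * (p : ℂ) ^ (-(Complex.I * t)))
    rw [norm_mul, hn, Complex.norm_real, norm_one, mul_one,
      Real.norm_of_nonneg (by rw [hrp]; linarith), h1r] at this
    exact this
  rw [h1r, two_mul, Real.exp_add, Real.exp_log (by positivity), norm_inv, ← sq, one_div]
  gcongr

end Primes

/-- Let `T ≥ 2`, `B > 0`, `X = B·log T·log log T`, and `r` completely multiplicative with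
`r p = 1 − p/X` for primes `p ≤ X`, `r p = 0` otherwise. Then
`∑_{p ≤ X} log(1/(1 − r p)) ≤ (B + o(1))·log T·log log T/log(log T·log log T)` and
consequently `∏_p |1 − r(p)p^{−it}|⁻² ≤ T^{2B + o(1)}` uniformly in `t` as `T → ∞`. -/
theorem resonator_size_bound (B : ℝ) (hB : 0 < B) :
    ∀ ε : ℝ, 0 < ε → ∃ T₀ : ℝ, 2 ≤ T₀ ∧ ∀ T : ℝ, T₀ ≤ T →
      ∀ r : ℕ → ℝ,
        (∀ p : ℕ, p.Prime → (p : ℝ) ≤ B * Real.log T * Real.log (Real.log T) →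
          r p = 1 - p / (B * Real.log T * Real.log (Real.log T))) →
        (∀ p : ℕ, p.Prime → B * Real.log T * Real.log (Real.log T) < (p : ℝ) → r p = 0) →
        ((∑ p ∈ (Finset.Icc 1 ⌊B * Real.log T * Real.log (Real.log T)⌋₊).filter Nat.Prime,
            Real.log (1 / (1 - r p))) ≤
          (B + ε) * Real.log T * Real.log (Real.log T) /
            Real.log (Real.log T * Real.log (Real.log T)) ∧
        ∀ t : ℝ,
          ∏ p ∈ (Finset.Icc 1 ⌊B * Real.log T * Real.log (Real.log T)⌋₊).filter Nat.Prime,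
            (‖(1 - (r p : ℂ) * (p : ℂ) ^ (-(Complex.I * t)))⁻¹‖ ^ 2) ≤
          T ^ (2 * B + ε)) := by
  intro ε hε
  have hδ : 0 < ε / 2 / (2 * B) := by positivity
  have t1 : Filter.Tendsto (fun T : ℝ => Real.log T) Filter.atTop Filter.atTop :=
    Real.tendsto_log_atTop
  have t2 : Filter.Tendsto (fun T : ℝ => Real.log (Real.log T)) Filter.atTop Filter.atTop :=
    t1.comp t1
  have t3 : Filter.Tendsto (fun T : ℝ => Real.log T * Real.log (Real.log T))
      Filter.atTop Filter.atTop := t1.atTop_mul_atTop₀ t2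
  have t4 : Filter.Tendsto (fun T : ℝ => B * Real.log T * Real.log (Real.log T))
      Filter.atTop Filter.atTop := by
    simp_rw [mul_assoc]
    exact t3.const_mul_atTop hB
  have t5 : Filter.Tendsto (fun T : ℝ => Real.log (Real.log T * Real.log (Real.log T)))
      Filter.atTop Filter.atTop := t1.comp t3
  have ev := (t4.eventually (sum_log_eventually _ hδ)).and
    ((t1.eventually_ge_atTop 1).and ((t2.eventually_ge_atTop 1).and
    ((t5.eventually_ge_atTop (1 + |Real.log B|)).and
    (t5.eventually_ge_atTop ((B + ε / 2) * |Real.log B| * 4 / ε)))))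
  obtain ⟨T₁, hT₁⟩ := Filter.eventually_atTop.1 ev
  refine ⟨max 2 T₁, le_max_left _ _, fun T hT r hr1 _ => ?_⟩
  obtain ⟨hsum, hl, hm, hP1, hP2⟩ := hT₁ T ((le_max_right _ _).trans hT)
  have hT0 : 0 < T := by linarith [(le_max_left 2 T₁).trans hT]
  set l := Real.log T with hldef
  set m := Real.log l with hmdef
  set P := Real.log (l * m) with hPdef
  have hl0 : 0 < l := by linarith
  have hm0 : 0 < m := by linarith
  have hX0 : 0 < B * l * m := by positivity
  have hlogX : Real.log (B * l * m) = Real.log B + P := by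
    rw [mul_assoc, Real.log_mul hB.ne' (by positivity)]
  have hab := neg_abs_le (Real.log B)
  have hab0 := abs_nonneg (Real.log B)
  have hP0 : 0 < P := by linarith
  have hLX : 0 < Real.log B + P := by linarith
  have first : (∑ p ∈ (Finset.Icc 1 ⌊B * l * m⌋₊).filter Nat.Prime,
      Real.log (1 / (1 - r p))) ≤ (B + ε / 2) * l * m / P := by
    have e : ∀ p ∈ (Finset.Icc 1 ⌊B * l * m⌋₊).filter Nat.Prime,
        Real.log (1 / (1 - r p)) = Real.log (B * l * m / p) := by
      intro p hp
      simp only [Finset.mem_filter, Finset.mem_Icc] at hp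
      rw [hr1 p hp.2 ((Nat.le_floor_iff hX0.le).1 hp.1.2), sub_sub_cancel, one_div_div]
    rw [Finset.sum_congr rfl e]
    refine hsum.trans ?_
    rw [hlogX, div_le_div_iff₀ hLX hP0]
    have e1 : (1 + ε / 2 / (2 * B)) * (B * l * m) * P = ((B + ε / 4) * P) * (l * m) := by
      field_simp
      ring
    have e2 : (B + ε / 2) * l * m * (Real.log B + P) =
      ((B + ε / 2) * (Real.log B + P)) * (l * m) := by ring
    rw [e1, e2]
    refine mul_le_mul_of_nonneg_right ?_ (by positivity)
    rw [div_le_iff₀ hε] at hP2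
    have := mul_le_mul_of_nonneg_left hab (by positivity : 0 ≤ B + ε / 2)
    linarith
  refine ⟨first.trans ?_, fun t => ?_⟩
  · gcongr
    linarith
  · refine (prod_bound (B * l * m) hX0 r hr1 t).trans ?_
    rw [Real.rpow_def_of_pos hT0]
    refine Real.exp_le_exp.2 ?_
    have hmP : m ≤ P := by
      rw [hPdef, Real.log_mul hl0.ne' hm0.ne']
      have := Real.log_nonneg hm
      linarith
    have : (B + ε / 2) * l * m / P ≤ (B + ε / 2) * l := by
      rw [div_le_iff₀ hP0]
      exact mul_le_mul_of_nonneg_left hmP (by positivity)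
    have e : l * (2 * B + ε) = 2 * ((B + ε / 2) * l) := by ring
    rw [← hldef, e]
    linarith
end
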